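/- For every integer n ≥ 1, let Sp(2n,ℂ) = {g ∈ GL(2n,ℂ) : gᵀ J g = J}, where J is the standard skew-symmetric 2n×2n matrix defining the symplectic form. Then the space Hom(ℤ², Sp(2n,ℂ))⁺/Sp(2n,ℂ) of conjugation classes of pairs of commuting semisimple elements of Sp(2n,ℂ) is homotopy equivalent to the complex projective space ℂP^{n}. -/

import Mathlib

open Matrix

/-- The space `Hom(ℤ^m, G)` of commuting `m`-tuples with entries in a subset `G`
of a monoid `M`, as a subset of `M^m` (with the subspace topology). -/
def commTuples {M : Type*} [Monoid M] (m : ℕ) (G : Set M) : Set (Fin m → M) :=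
  {f | (∀ i, f i ∈ G) ∧ ∀ i j, f i * f j = f j * f i}

/-- Simultaneous conjugation, by elements of `G` (together with their inverses in `G`),
of tuples lying in a subset `S` of `M^m`. -/
def conjRel {M : Type*} [Monoid M] {m : ℕ} (G : Set M) (S : Set (Fin m → M)) :
    S → S → Prop := fun x y =>
  ∃ g gi : M, g ∈ G ∧ gi ∈ G ∧ g * gi = 1 ∧ gi * g = 1 ∧
    ∀ i, g * (x : Fin m → M) i * gi = (y : Fin m → M) i

/-- The conjugation orbit space `S/G`, with the quotient topology. -/
abbrev RepSpace {M : Type*} [Monoid M] [TopologicalSpace M] {m : ℕ} (G : Set M)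
    (S : Set (Fin m → M)) : Type _ := Quot (conjRel G S)

/-- `A` is a strong deformation retract of `X`. -/
def IsStrongDeformationRetract {X : Type*} [TopologicalSpace X] (A : Set X) : Prop :=
  ∃ H : X × unitInterval → X, Continuous H ∧
    (∀ x, H (x, 0) = x) ∧ (∀ x, H (x, 1) ∈ A) ∧ (∀ a ∈ A, ∀ t, H (a, t) = a)

/-- A complex square matrix is semisimple if it is diagonalizable over `ℂ`. -/
def IsSemisimpleMat {n : ℕ} (A : Matrix (Fin n) (Fin n) ℂ) : Prop :=
  ∃ P Pi : Matrix (Fin n) (Fin n) ℂ, P * Pi = 1 ∧ Pi * P = 1 ∧ (Pi * A * P).IsDiag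

/-- The subspace `Hom(ℤ^m, G)⁺` of commuting `m`-tuples in `G` all of whose entries
are semisimple. -/
def ssTuples (m : ℕ) {n : ℕ} (G : Set (Matrix (Fin n) (Fin n) ℂ)) :
    Set (Fin m → Matrix (Fin n) (Fin n) ℂ) :=
  {f | f ∈ commTuples m G ∧ ∀ i, IsSemisimpleMat (f i)}

/-- `GL(n,ℂ)` as the set of invertible complex `n × n` matrices. -/
def GLset (n : ℕ) : Set (Matrix (Fin n) (Fin n) ℂ) := {A | IsUnit A}

/-- `U(n)` as a set of complex `n × n` matrices. -/
def Uset (n : ℕ) : Set (Matrix (Fin n) (Fin n) ℂ) := Matrix.unitaryGroup (Fin n) ℂ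

/-- `SL(n,ℂ)` as the set of complex `n × n` matrices of determinant one. -/
def SLset (n : ℕ) : Set (Matrix (Fin n) (Fin n) ℂ) := {A | A.det = 1}

/-- `SU(n)` as a set of complex `n × n` matrices. -/
def SUset (n : ℕ) : Set (Matrix (Fin n) (Fin n) ℂ) :=
  {A | A ∈ Matrix.unitaryGroup (Fin n) ℂ ∧ A.det = 1}

/-- The standard skew-symmetric `2n × 2n` matrix `J` defining the symplectic form,
viewed as a matrix indexed by `Fin (2*n)`. -/
noncomputable def Jstd (n : ℕ) : Matrix (Fin (2*n)) (Fin (2*n)) ℂ :=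
  Matrix.reindex (finSumFinEquiv.trans (finCongr (two_mul n).symm))
    (finSumFinEquiv.trans (finCongr (two_mul n).symm)) (Matrix.J (Fin n) ℂ)

/-- `Sp(2n,ℂ) = {g ∈ GL(2n,ℂ) : gᵀ J g = J}` as a set of complex `2n × 2n` matrices. -/
def Spset (n : ℕ) : Set (Matrix (Fin (2*n)) (Fin (2*n)) ℂ) :=
  {A | IsUnit A ∧ Aᵀ * Jstd n * A = Jstd n}

/-- The projectivization of `ℂ^{n+1}` (i.e. the complex projective space `ℂP^n`),
with its standard (quotient) topology. -/
noncomputable instance (k : ℕ) : TopologicalSpace (Projectivization ℂ (Fin k → ℂ)) := by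
  unfold Projectivization; infer_instance

namespace SpPairs

lemma continuous_projMk (k : ℕ) :
    Continuous (Projectivization.mk' ℂ : {v : Fin k → ℂ // v ≠ 0} → _) :=
  continuous_quotient_mk'

/-- The rank one projector attached to a line, which embeds projective space in a
space of matrices. -/
noncomputable def lineProjector (k : ℕ) :
    Projectivization ℂ (Fin k → ℂ) → Fin k → Fin k → ℂ :=
  Projectivization.lift
    (fun v i j => v.1 i * star (v.1 j) / ∑ l, v.1 l * star (v.1 l)) (by
      rintro ⟨a, ha⟩ ⟨b, hb⟩ t h
      simp only at h
      subst h
      have ht : t ≠ 0 := fun h => ha (by simp [h])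
      have ht' : star t ≠ 0 := star_ne_zero.2 ht
      funext i j
      have : ∑ l, (t • b) l * star ((t • b) l) = (t * star t) * ∑ l, b l * star (b l) := by
        rw [Finset.mul_sum]
        refine Finset.sum_congr rfl fun l _ => ?_
        simp only [Pi.smul_apply, smul_eq_mul, star_mul']
        ring
      simp only [this]
      simp only [Pi.smul_apply, smul_eq_mul, star_mul']
      rw [show t * b i * (star t * star (b j)) = (t * star t) * (b i * star (b j)) by ring]
      exact mul_div_mul_left _ _ (mul_ne_zero ht ht'))

lemma sum_mul_star_ne_zero {k : ℕ} {v : Fin k → ℂ} (hv : v ≠ 0) :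
    ∑ l, v l * star (v l) ≠ 0 := by
  intro h
  open scoped ComplexOrder in
  exact hv (dotProduct_self_star_eq_zero.1 h)

lemma continuous_lineProjector (k : ℕ) : Continuous (lineProjector k) := by
  refine continuous_quot_lift _ ?_
  have hc (l : Fin k) : Continuous fun v : {v : Fin k → ℂ // v ≠ 0} => v.1 l :=
    (continuous_apply l).comp continuous_subtype_val
  refine continuous_pi fun i => continuous_pi fun j => ?_
  refine Continuous.div ?_ ?_ fun v => sum_mul_star_ne_zero v.2
  · exact (hc i).mul (hc j).star
  · exact continuous_finsetSum _ fun l _ => (hc l).mul (hc l).star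

lemma lineProjector_injective (k : ℕ) : Function.Injective (lineProjector k) := by
  intro x y
  induction x with | h v hv => ?_
  induction y with | h w hw => ?_
  intro h
  simp only [lineProjector, Projectivization.lift_mk] at h
  rw [Projectivization.mk_eq_mk_iff']
  obtain ⟨j, hj⟩ := Function.ne_iff.1 hv
  have hj' : star (v j) ≠ 0 := star_ne_zero.2 hj
  have hv' := sum_mul_star_ne_zero hv
  have hw' := sum_mul_star_ne_zero hw
  refine ⟨star (w j) / (∑ l, w l * star (w l)) * (∑ l, v l * star (v l)) / star (v j), ?_⟩
  funext i
  have hi := congrFun (congrFun h i) j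
  simp only [Pi.smul_apply, smul_eq_mul]
  field_simp at hi ⊢
  linear_combination -hi

instance projectivization_t2Space (k : ℕ) : T2Space (Projectivization ℂ (Fin k → ℂ)) :=
  T2Space.of_injective_continuous (lineProjector_injective k) (continuous_lineProjector k)

lemma exists_perm_of_map_univ_eq {ι α : Type*} [Fintype ι] {f g : ι → α}
    (h : (Finset.univ : Finset ι).val.map f = (Finset.univ : Finset ι).val.map g) :
    ∃ σ : Equiv.Perm ι, ∀ i, g (σ i) = f i := by
  classical
  have hc (a : α) : Nonempty ({i // f i = a} ≃ {i // g i = a}) := by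
    refine ⟨Fintype.equivOfCardEq ?_⟩
    have := congrArg (Multiset.count a) h
    rw [Multiset.count_map, Multiset.count_map] at this
    simp only [Fintype.card_subtype, eq_comm (b := a)]
    exact this
  exact ⟨Equiv.ofFiberEquiv fun a => (hc a).some, fun i => Equiv.ofFiberEquiv_map _ i⟩

open Polynomial in
/-- The linear polynomial with the given coefficients. -/
noncomputable def linPoly (p : ℂ × ℂ) : ℂ[X] := C p.1 * X + C p.2

lemma linPoly_ne_zero {p : ℂ × ℂ} (hp : p ≠ 0) : linPoly p ≠ 0 := by
  intro h
  have h0 := congrArg (fun q => Polynomial.coeff q 0) h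
  have h1 := congrArg (fun q => Polynomial.coeff q 1) h
  simp [linPoly] at h0 h1
  exact hp (Prod.ext h1 h0)

lemma natDegree_linPoly_le (p : ℂ × ℂ) : (linPoly p).natDegree ≤ 1 :=
  Polynomial.natDegree_linear_le

/-- The point of the projective line at which a linear polynomial vanishes, with
`none` standing for infinity. -/
noncomputable def vanishingPt (p : ℂ × ℂ) : Option ℂ :=
  if p.1 = 0 then none else some (-p.2 / p.1)

lemma cross_of_vanishingPt_eq {p q : ℂ × ℂ} (h : vanishingPt p = vanishingPt q) :
    p.1 * q.2 = p.2 * q.1 := by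
  unfold vanishingPt at h
  split_ifs at h with h1 h2 h2
  · simp [h1, h2]
  · rw [Option.some_inj] at h
    field_simp at h
    linear_combination h

lemma exists_smul_of_cross {p q : ℂ × ℂ} (hp : p ≠ 0) (hq : q ≠ 0)
    (h : p.1 * q.2 = p.2 * q.1) : ∃ c : ℂ, c ≠ 0 ∧ q = c • p := by
  by_cases h1 : p.1 = 0
  · have h2 : p.2 ≠ 0 := fun h2 => hp (Prod.ext h1 h2)
    have h3 : q.1 = 0 := by simpa [h1, h2] using h
    have h4 : q.2 ≠ 0 := fun h4 => hq (Prod.ext h3 h4)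
    exact ⟨q.2 / p.2, div_ne_zero h4 h2, Prod.ext (by simp [h1, h3]) (by simp [h2])⟩
  · have h4 : q.1 ≠ 0 := by
      intro h4
      have : q.2 = 0 := by simpa [h4, h1] using h
      exact hq (Prod.ext h4 this)
    refine ⟨q.1 / p.1, div_ne_zero h4 h1, Prod.ext (by simp [h1]) ?_⟩
    simp only [Prod.smul_snd, smul_eq_mul]
    field_simp
    linear_combination h

lemma natDegree_prod_linPoly_le {ι : Type*} (s : Finset ι) (L : ι → ℂ × ℂ) :
    (∏ i ∈ s, linPoly (L i)).natDegree ≤ s.card := by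
  refine (Polynomial.natDegree_prod_le _ _).trans ?_
  simpa using Finset.sum_le_sum fun i (_ : i ∈ s) => natDegree_linPoly_le (L i)

lemma map_vanishingPt_eq {ι : Type*} (s : Finset ι) (L : ι → ℂ × ℂ) (hL : ∀ i, L i ≠ 0) :
    s.val.map (fun i => vanishingPt (L i)) =
      (∏ i ∈ s, linPoly (L i)).roots.map some +
        Multiset.replicate (s.card - (∏ i ∈ s, linPoly (L i)).natDegree) none := by
  classical
  induction s using Finset.induction_on with
  | empty => simp
  | insert a s ha ih =>
    have h0 : ∏ i ∈ s, linPoly (L i) ≠ 0 :=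
      Finset.prod_ne_zero_iff.2 fun i _ => linPoly_ne_zero (hL i)
    have ha0 := linPoly_ne_zero (hL a)
    have hd := natDegree_prod_linPoly_le s L
    rw [Finset.insert_val_of_notMem ha, Multiset.map_cons, ih, Finset.prod_insert ha,
      Polynomial.roots_mul (mul_ne_zero ha0 h0), Polynomial.natDegree_mul ha0 h0,
      Finset.card_insert_of_notMem ha]
    by_cases h1 : (L a).1 = 0
    · have h2 : linPoly (L a) = Polynomial.C (L a).2 := by simp [linPoly, h1]
      rw [h2]
      simp only [vanishingPt, h1, if_true, Polynomial.roots_C, Polynomial.natDegree_C, zero_add]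
      rw [Nat.sub_add_comm hd, Multiset.replicate_succ, Multiset.add_cons]
    · have h2 : (linPoly (L a)).natDegree = 1 := Polynomial.natDegree_linear h1
      have h3 : (linPoly (L a)).roots = {-(L a).2 / (L a).1} := by
        rw [linPoly, Polynomial.roots_C_mul_X_add_C _ h1]
        congr 1
        field_simp
      rw [h2, h3, add_comm 1, Nat.add_sub_add_right]
      simp [vanishingPt, h1]

/-- The coefficient vector of a product of linear polynomials. -/
noncomputable def prodCoeff {n : ℕ} (L : Fin n → ℂ × ℂ) : Fin (n + 1) → ℂ :=
  fun k => (∏ i, linPoly (L i)).coeff k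

lemma coeff_ext_of_natDegree_le {n : ℕ} {p q : Polynomial ℂ} (hp : p.natDegree ≤ n)
    (hq : q.natDegree ≤ n) (h : ∀ k : Fin (n + 1), p.coeff k = q.coeff k) : p = q := by
  ext k
  rcases lt_or_ge n k with hk | hk
  · rw [Polynomial.coeff_eq_zero_of_natDegree_lt (hp.trans_lt hk),
      Polynomial.coeff_eq_zero_of_natDegree_lt (hq.trans_lt hk)]
  · exact h ⟨k, Nat.lt_succ_of_le hk⟩

lemma natDegree_prod_univ_linPoly_le {n : ℕ} (L : Fin n → ℂ × ℂ) :
    (∏ i, linPoly (L i)).natDegree ≤ n := by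
  simpa using natDegree_prod_linPoly_le Finset.univ L

lemma prodCoeff_ne_zero {n : ℕ} {L : Fin n → ℂ × ℂ} (hL : ∀ i, L i ≠ 0) :
    prodCoeff L ≠ 0 := by
  intro h
  have : ∏ i, linPoly (L i) = 0 :=
    coeff_ext_of_natDegree_le (natDegree_prod_univ_linPoly_le L) (by simp)
      fun k => (congrFun h k).trans (by simp)
  exact Finset.prod_ne_zero_iff.2 (fun i _ => linPoly_ne_zero (hL i)) this

lemma continuous_coeff_prod {ι : Type*} (s : Finset ι) (k : ℕ) :
    Continuous fun L : ι → ℂ × ℂ => (∏ i ∈ s, linPoly (L i)).coeff k := by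
  classical
  induction s using Finset.induction_on generalizing k with
  | empty => simpa using continuous_const
  | insert a s ha ih =>
    simp only [Finset.prod_insert ha, Polynomial.coeff_mul]
    refine continuous_finsetSum _ fun p _ => Continuous.mul ?_ (ih p.2)
    simp only [linPoly, Polynomial.coeff_add, Polynomial.coeff_C_mul, Polynomial.coeff_X,
      Polynomial.coeff_C]
    split_ifs <;> fun_prop

lemma continuous_prodCoeff (n : ℕ) :
    Continuous (prodCoeff : (Fin n → ℂ × ℂ) → Fin (n + 1) → ℂ) :=
  continuous_pi fun k => continuous_coeff_prod _ (k : ℕ)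

lemma prodCoeff_smul {n : ℕ} (L : Fin n → ℂ × ℂ) (c : Fin n → ℂ) :
    prodCoeff (fun i => c i • L i) = (∏ i, c i) • prodCoeff L := by
  have h : ∏ i, linPoly (c i • L i) = Polynomial.C (∏ i, c i) * ∏ i, linPoly (L i) := by
    rw [map_prod, ← Finset.prod_mul_distrib]
    refine Finset.prod_congr rfl fun i _ => ?_
    simp only [linPoly, Prod.smul_fst, Prod.smul_snd, smul_eq_mul, map_mul]
    ring
  funext k
  simp only [prodCoeff, h, Polynomial.coeff_C_mul, Pi.smul_apply, smul_eq_mul]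

lemma prodCoeff_perm {n : ℕ} (L : Fin n → ℂ × ℂ) (σ : Equiv.Perm (Fin n)) :
    prodCoeff (fun i => L (σ i)) = prodCoeff L := by
  funext k
  simp only [prodCoeff]
  rw [Equiv.prod_comp σ fun i => linPoly (L i)]

lemma exists_perm_of_prodCoeff {n : ℕ} {L L' : Fin n → ℂ × ℂ} (hL : ∀ i, L i ≠ 0)
    (hL' : ∀ i, L' i ≠ 0) {c : ℂ} (h : c • prodCoeff L = prodCoeff L') :
    ∃ σ : Equiv.Perm (Fin n), ∀ i, (L (σ i)).1 * (L' i).2 = (L (σ i)).2 * (L' i).1 := by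
  have hc : c ≠ 0 := by
    rintro rfl
    exact prodCoeff_ne_zero hL' (by rw [← h, zero_smul])
  have h1 : ∏ i, linPoly (L' i) = Polynomial.C c * ∏ i, linPoly (L i) := by
    refine coeff_ext_of_natDegree_le (natDegree_prod_univ_linPoly_le L')
      ((Polynomial.natDegree_C_mul_le _ _).trans (natDegree_prod_univ_linPoly_le L)) fun k => ?_
    rw [Polynomial.coeff_C_mul]
    exact (congrFun h k).symm
  have h2 := map_vanishingPt_eq Finset.univ L' hL'
  rw [h1, Polynomial.roots_C_mul _ hc, Polynomial.natDegree_C_mul hc,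
    ← map_vanishingPt_eq Finset.univ L hL] at h2
  obtain ⟨σ, hσ⟩ := exists_perm_of_map_univ_eq h2
  exact ⟨σ, fun i => cross_of_vanishingPt_eq (hσ i)⟩

lemma exists_prod_linPoly (n : ℕ) (p : Polynomial ℂ) (hp : p ≠ 0) (hd : p.natDegree ≤ n) :
    ∃ (c : ℂ) (L : Fin n → ℂ × ℂ), (∀ i, L i ≠ 0) ∧
      p = Polynomial.C c * ∏ i, linPoly (L i) := by
  induction n generalizing p with
  | zero =>
    refine ⟨p.coeff 0, Fin.elim0, fun i => i.elim0, ?_⟩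
    simpa using Polynomial.eq_C_of_natDegree_le_zero hd
  | succ n ih =>
    by_cases hd' : p.natDegree ≤ n
    · obtain ⟨c, L, hL, h⟩ := ih p hp hd'
      refine ⟨c, Fin.cons (0, 1) L, fun i => ?_, ?_⟩
      · refine Fin.cases ?_ (fun i => ?_) i
        · simp
        · simpa using hL i
      · rw [h, Fin.prod_univ_succ]
        simp [linPoly]
    · have hdeg : p.degree ≠ 0 := by
        intro h0
        rw [Polynomial.natDegree_eq_of_degree_eq_some h0] at hd'
        exact hd' (Nat.zero_le _)
      obtain ⟨r, hr⟩ := IsAlgClosed.exists_root p hdeg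
      obtain ⟨q, rfl⟩ := Polynomial.dvd_iff_isRoot.2 hr
      have hq : q ≠ 0 := right_ne_zero_of_mul hp
      rw [Polynomial.natDegree_mul (Polynomial.X_sub_C_ne_zero r) hq,
        Polynomial.natDegree_X_sub_C] at hd
      obtain ⟨c, L, hL, h⟩ := ih q hq (by omega)
      refine ⟨c, Fin.cons (1, -r) L, fun i => ?_, ?_⟩
      · refine Fin.cases ?_ (fun i => ?_) i
        · simp
        · simpa using hL i
      · rw [h, Fin.prod_univ_succ]
        simp [linPoly]
        ring

lemma exists_smul_prodCoeff {n : ℕ} {v : Fin (n + 1) → ℂ} (hv : v ≠ 0) :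
    ∃ (c : ℂ) (L : Fin n → ℂ × ℂ), (∀ i, L i ≠ 0) ∧ v = c • prodCoeff L := by
  set p : Polynomial ℂ := ∑ k : Fin (n + 1), Polynomial.monomial k (v k)
  have hp (k : Fin (n + 1)) : p.coeff k = v k := by
    simp [p, Polynomial.coeff_monomial, Fin.val_inj]
  have hd : p.natDegree ≤ n :=
    Polynomial.natDegree_sum_le_of_forall_le _ _ fun k _ =>
      (Polynomial.natDegree_monomial_le _).trans (Nat.lt_succ_iff.1 k.2)
  have hp0 : p ≠ 0 := by
    intro h
    exact hv (funext fun k => by simp [← hp k, h])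
  obtain ⟨c, L, hL, h⟩ := exists_prod_linPoly n p hp0 hd
  refine ⟨c, L, hL, funext fun k => ?_⟩
  rw [← hp k, h, Polynomial.coeff_C_mul]
  rfl

lemma pillow_scale_unique {x y u l : ℝ} (hl : 0 < l) (hx : x ^ 2 ≤ 1) (hy : y ^ 2 ≤ 1)
    (hu : u ^ 2 = (1 - x ^ 2) * (1 - y ^ 2)) (hx' : (l * x) ^ 2 ≤ 1) (hy' : (l * y) ^ 2 ≤ 1)
    (hu' : (l * u) ^ 2 = (1 - (l * x) ^ 2) * (1 - (l * y) ^ 2)) : l = 1 := by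
  have key : ∀ {x y u m : ℝ}, 1 < m → x ^ 2 ≤ 1 → y ^ 2 ≤ 1 →
      u ^ 2 = (1 - x ^ 2) * (1 - y ^ 2) → m * x ^ 2 ≤ 1 → m * y ^ 2 ≤ 1 →
      m * u ^ 2 = (1 - m * x ^ 2) * (1 - m * y ^ 2) → False := by
    intro x y u m hm hx hy hu hx' hy' hu'
    have hx0 := sq_nonneg x
    have hy0 := sq_nonneg y
    have hu0 := sq_nonneg u
    have h1 : (1 - m * x ^ 2) * (1 - m * y ^ 2) ≤ (1 - x ^ 2) * (1 - y ^ 2) := by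
      apply mul_le_mul <;> nlinarith
    have h2 : u ^ 2 = 0 := by nlinarith
    rw [h2] at hu
    rcases mul_eq_zero.1 hu.symm with h | h <;> nlinarith
  rcases lt_trichotomy l 1 with h | h | h
  · exfalso
    have hl2 : 0 < l ^ 2 := by positivity
    refine key (x := l * x) (y := l * y) (u := l * u) (m := (l ^ 2)⁻¹) ?_ hx' hy' hu' ?_ ?_ ?_
    · rw [one_lt_inv₀ hl2]; nlinarith
    · rw [mul_pow, inv_mul_cancel_left₀ hl2.ne']; exact hx
    · rw [mul_pow, inv_mul_cancel_left₀ hl2.ne']; exact hy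
    · simp only [mul_pow, inv_mul_cancel_left₀ hl2.ne']; exact hu
  · exact h
  · exact (key (x := x) (y := y) (u := u) (m := l ^ 2) (by nlinarith) hx hy hu
      (by rwa [← mul_pow]) (by rwa [← mul_pow]) (by simpa only [← mul_pow] using hu')).elim

lemma pillow_scale_exists {x y u : ℝ} (h : x ^ 2 + y ^ 2 + u ^ 2 = 1) :
    ∃ l : ℝ, 0 < l ∧ (l * x) ^ 2 ≤ 1 ∧ (l * y) ^ 2 ≤ 1 ∧
      (l * u) ^ 2 = (1 - (l * x) ^ 2) * (1 - (l * y) ^ 2) := by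
  have hd : 0 ≤ 1 - 4 * (x ^ 2 * y ^ 2) := by
    nlinarith [sq_nonneg (x ^ 2 - y ^ 2), sq_nonneg u, sq_nonneg x, sq_nonneg y]
  set s := √(1 - 4 * (x ^ 2 * y ^ 2)) with hs
  have hs0 : 0 ≤ s := Real.sqrt_nonneg _
  have hs2 : s ^ 2 = 1 - 4 * (x ^ 2 * y ^ 2) := Real.sq_sqrt hd
  set m := 2 / (1 + s) with hm
  have hs1 : 0 < 1 + s := by linarith
  have hm0 : 0 < m := by positivity
  have hms : m * (1 + s) = 2 := by rw [hm]; field_simp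
  have hmq : x ^ 2 * y ^ 2 * m ^ 2 - m + 1 = 0 := by
    have : x ^ 2 * y ^ 2 = (1 - s ^ 2) / 4 := by linarith
    rw [this, hm]
    field_simp
    ring
  have hb : ∀ a b : ℝ, a + b ≤ 1 → 0 ≤ a → 0 ≤ b → s ^ 2 = 1 - 4 * (a * b) → m * a ≤ 1 := by
    intro a b hab ha hb hsab
    have : 2 * a ≤ 1 + s := by
      by_contra! hc
      nlinarith
    rw [hm, div_mul_eq_mul_div, div_le_one hs1]
    exact this
  have hx := hb (x ^ 2) (y ^ 2) (by nlinarith [sq_nonneg u]) (sq_nonneg _) (sq_nonneg _) hs2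
  have hy := hb (y ^ 2) (x ^ 2) (by nlinarith [sq_nonneg u]) (sq_nonneg _) (sq_nonneg _)
    (by rw [hs2]; ring)
  have hsm : √m ^ 2 = m := Real.sq_sqrt hm0.le
  refine ⟨√m, Real.sqrt_pos.2 hm0, by rwa [mul_pow, hsm], by rwa [mul_pow, hsm], ?_⟩
  simp only [mul_pow, hsm]
  have hu : u ^ 2 = 1 - x ^ 2 - y ^ 2 := by linarith
  rw [hu]
  linear_combination -hmq

/-- The first coordinate of a point of the torus in its pillowcase quotient. -/
noncomputable def pillowX (e : Circle × Circle) : ℝ := (e.1 : ℂ).re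

/-- The second coordinate of a point of the torus in its pillowcase quotient. -/
noncomputable def pillowY (e : Circle × Circle) : ℝ := (e.2 : ℂ).re

/-- The third coordinate of a point of the torus in its pillowcase quotient. -/
noncomputable def pillowU (e : Circle × Circle) : ℝ := (e.1 : ℂ).im * (e.2 : ℂ).im

/-- The distance to the origin of a point of the pillowcase. -/
noncomputable def pillowR (e : Circle × Circle) : ℝ :=
  √(pillowX e ^ 2 + pillowY e ^ 2 + pillowU e ^ 2)

lemma circle_re_sq_add_im_sq (z : Circle) : (z : ℂ).re ^ 2 + (z : ℂ).im ^ 2 = 1 := by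
  have := Circle.normSq_coe z
  rw [Complex.normSq_apply] at this
  linarith

lemma pillow_bounds (e : Circle × Circle) : pillowX e ^ 2 ≤ 1 ∧ pillowY e ^ 2 ≤ 1 ∧
    pillowU e ^ 2 = (1 - pillowX e ^ 2) * (1 - pillowY e ^ 2) := by
  have h1 := circle_re_sq_add_im_sq e.1
  have h2 := circle_re_sq_add_im_sq e.2
  refine ⟨by unfold pillowX; nlinarith [sq_nonneg (e.1 : ℂ).im],
    by unfold pillowY; nlinarith [sq_nonneg (e.2 : ℂ).im], ?_⟩
  unfold pillowU pillowX pillowY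
  have h3 : 1 - (e.1 : ℂ).re ^ 2 = (e.1 : ℂ).im ^ 2 := by linarith
  have h4 : 1 - (e.2 : ℂ).re ^ 2 = (e.2 : ℂ).im ^ 2 := by linarith
  rw [h3, h4, mul_pow]

lemma pillowR_pos (e : Circle × Circle) : 0 < pillowR e := by
  obtain ⟨-, -, h⟩ := pillow_bounds e
  refine Real.sqrt_pos.2 ?_
  have hx := sq_nonneg (pillowX e)
  have hy := sq_nonneg (pillowY e)
  nlinarith [mul_nonneg hx hy]

lemma pillowR_sq (e : Circle × Circle) :
    pillowR e ^ 2 = pillowX e ^ 2 + pillowY e ^ 2 + pillowU e ^ 2 :=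
  Real.sq_sqrt (by positivity)

lemma eq_or_eq_inv_of_re_eq {z w : Circle} (h : (z : ℂ).re = (w : ℂ).re) :
    z = w ∨ z = w⁻¹ := by
  have h1 := circle_re_sq_add_im_sq z
  have h2 := circle_re_sq_add_im_sq w
  have h3 : (z : ℂ).im ^ 2 = (w : ℂ).im ^ 2 := by rw [h] at h1; linarith
  rcases sq_eq_sq_iff_eq_or_eq_neg.1 h3 with h4 | h4
  · exact Or.inl (Circle.ext (Complex.ext h h4))
  · refine Or.inr (Circle.ext (Complex.ext ?_ ?_))
    · simp [h]
    · simp [h4]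

lemma eq_inv_of_im_eq_zero {z : Circle} (h : (z : ℂ).im = 0) : z = z⁻¹ := by
  refine Circle.ext (Complex.ext ?_ ?_) <;> simp [h]

lemma eq_or_eq_inv_of_pillow_eq {e f : Circle × Circle} (hx : pillowX e = pillowX f)
    (hy : pillowY e = pillowY f) (hu : pillowU e = pillowU f) : e = f ∨ e = f⁻¹ := by
  obtain ⟨z, w⟩ := e
  obtain ⟨z', w'⟩ := f
  simp only [pillowX, pillowY, pillowU] at hx hy hu
  rcases eq_or_eq_inv_of_re_eq hx with rfl | rfl <;>
    rcases eq_or_eq_inv_of_re_eq hy with rfl | rfl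
  · exact Or.inl rfl
  · have h : (z : ℂ).im * (w' : ℂ).im = 0 := by
      simp at hu ⊢
      by_contra! hc
      exact mul_ne_zero hc.1 hc.2 (by linarith)
    rcases mul_eq_zero.1 h with h | h
    · right
      rw [Prod.inv_mk, ← eq_inv_of_im_eq_zero h]
    · left
      rw [← eq_inv_of_im_eq_zero h]
  · have h : (z' : ℂ).im * (w : ℂ).im = 0 := by
      simp at hu ⊢
      by_contra! hc
      exact mul_ne_zero hc.1 hc.2 (by linarith)
    rcases mul_eq_zero.1 h with h | h
    · left
      rw [← eq_inv_of_im_eq_zero h]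
    · right
      rw [Prod.inv_mk, ← eq_inv_of_im_eq_zero h]
  · exact Or.inr rfl

lemma exists_circle_re_eq {x : ℝ} (hx : x ^ 2 ≤ 1) :
    ∃ z : Circle, (z : ℂ).re = x ∧ (z : ℂ).im = √(1 - x ^ 2) := by
  refine ⟨⟨⟨x, √(1 - x ^ 2)⟩, ?_⟩, rfl, rfl⟩
  rw [Submonoid.unitSphere, ← SetLike.mem_coe]
  simp only [Submonoid.coe_set_mk, Subsemigroup.coe_set_mk, mem_sphere_zero_iff_norm]
  rw [Complex.norm_def, Complex.normSq_mk, Real.mul_self_sqrt (by linarith)]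
  simp [← sq]

lemma exists_pillow_eq {x y u : ℝ} (hx : x ^ 2 ≤ 1) (hy : y ^ 2 ≤ 1)
    (hu : u ^ 2 = (1 - x ^ 2) * (1 - y ^ 2)) :
    ∃ e : Circle × Circle, pillowX e = x ∧ pillowY e = y ∧ pillowU e = u := by
  obtain ⟨z, hz, hz'⟩ := exists_circle_re_eq hx
  obtain ⟨w, hw, hw'⟩ := exists_circle_re_eq hy
  have h : u ^ 2 = ((z : ℂ).im * (w : ℂ).im) ^ 2 := by
    rw [hz', hw', mul_pow, Real.sq_sqrt (by linarith), Real.sq_sqrt (by linarith), hu]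
  rcases sq_eq_sq_iff_eq_or_eq_neg.1 h with h | h
  · exact ⟨(z, w), hz, hw, h.symm⟩
  · exact ⟨(z, w⁻¹), hz, by simp [pillowY, hw],
      by simp [pillowU, h]⟩

/-- Homogeneous coordinates of the stereographic projection from the north pole. -/
noncomputable def northCoord (e : Circle × Circle) : ℂ × ℂ :=
  (⟨pillowX e, pillowY e⟩, (pillowR e - pillowU e : ℝ))

/-- Homogeneous coordinates of the stereographic projection from the south pole. -/
noncomputable def southCoord (e : Circle × Circle) : ℂ × ℂ :=
  ((pillowR e + pillowU e : ℝ), ⟨pillowX e, -pillowY e⟩)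

/-- Homogeneous coordinates on the projective line of a point of the torus, after
passing to its quotient by inversion. -/
noncomputable def torusCoord (e : Circle × Circle) : ℂ × ℂ :=
  if pillowU e ≤ 0 then northCoord e else southCoord e

lemma northCoord_ne_zero {e : Circle × Circle} (h : pillowU e ≤ 0) : northCoord e ≠ 0 := by
  intro h0
  have h1 := congrArg (fun p : ℂ × ℂ => p.2.re) h0
  simp [northCoord] at h1
  linarith [pillowR_pos e]

lemma southCoord_ne_zero {e : Circle × Circle} (h : 0 ≤ pillowU e) : southCoord e ≠ 0 := by
  intro h0
  have h1 := congrArg (fun p : ℂ × ℂ => p.1.re) h0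
  simp [southCoord] at h1
  linarith [pillowR_pos e]

lemma torusCoord_ne_zero (e : Circle × Circle) : torusCoord e ≠ 0 := by
  unfold torusCoord
  split_ifs with h
  · exact northCoord_ne_zero h
  · exact southCoord_ne_zero (not_le.1 h).le

lemma north_cross_south (e : Circle × Circle) :
    (northCoord e).1 * (southCoord e).2 = (northCoord e).2 * (southCoord e).1 := by
  have h := pillowR_sq e
  apply Complex.ext
  · simp [northCoord, southCoord]
    linear_combination -h
  · simp [northCoord, southCoord]
    ring

lemma torusCoord_cross_north (e : Circle × Circle) :
    (torusCoord e).1 * (northCoord e).2 = (torusCoord e).2 * (northCoord e).1 := by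
  unfold torusCoord
  split_ifs
  · ring
  · linear_combination -north_cross_south e

lemma torusCoord_cross_south (e : Circle × Circle) :
    (torusCoord e).1 * (southCoord e).2 = (torusCoord e).2 * (southCoord e).1 := by
  unfold torusCoord
  split_ifs
  · exact north_cross_south e
  · ring

lemma continuous_pillow : Continuous pillowX ∧ Continuous pillowY ∧ Continuous pillowU ∧
    Continuous pillowR := by
  have hx : Continuous pillowX := by unfold pillowX; fun_prop
  have hy : Continuous pillowY := by unfold pillowY; fun_prop
  have hu : Continuous pillowU := by unfold pillowU; fun_prop
  refine ⟨hx, hy, hu, ?_⟩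
  unfold pillowR
  fun_prop

lemma continuous_complex_mk {X : Type*} [TopologicalSpace X] {f g : X → ℝ} (hf : Continuous f)
    (hg : Continuous g) : Continuous fun x => (⟨f x, g x⟩ : ℂ) :=
  Complex.equivRealProdCLM.symm.continuous.comp (hf.prodMk hg)

lemma continuous_northCoord : Continuous northCoord := by
  obtain ⟨hx, hy, hu, hr⟩ := continuous_pillow
  exact (continuous_complex_mk hx hy).prodMk (Complex.continuous_ofReal.comp (hr.sub hu))

lemma continuous_southCoord : Continuous southCoord := by
  obtain ⟨hx, hy, hu, hr⟩ := continuous_pillow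
  exact (Complex.continuous_ofReal.comp (hr.add hu)).prodMk (continuous_complex_mk hx hy.neg)

lemma torusCoord_inv (e : Circle × Circle) : torusCoord e⁻¹ = torusCoord e := by
  have hx : pillowX e⁻¹ = pillowX e := by simp [pillowX]
  have hy : pillowY e⁻¹ = pillowY e := by simp [pillowY]
  have hu : pillowU e⁻¹ = pillowU e := by simp [pillowU]
  simp [torusCoord, northCoord, southCoord, pillowR, hx, hy, hu]

lemma exists_torusCoord_cross {p : ℂ × ℂ} (hp : p ≠ 0) :
    ∃ e, (torusCoord e).1 * p.2 = (torusCoord e).2 * p.1 := by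
  obtain ⟨⟨a, b⟩, ⟨c, d⟩⟩ := p
  have hN : 0 < a ^ 2 + b ^ 2 + c ^ 2 + d ^ 2 := by
    by_contra! h
    refine hp (Prod.ext (Complex.ext ?_ ?_) (Complex.ext ?_ ?_)) <;>
      simp only [Prod.fst_zero, Prod.snd_zero, Complex.zero_re, Complex.zero_im] <;> nlinarith
  set N := a ^ 2 + b ^ 2 + c ^ 2 + d ^ 2 with hNdef
  obtain ⟨l, hl, hx, hy, hu⟩ := pillow_scale_exists (x := 2 * (a * c + b * d) / N)
    (y := 2 * (b * c - a * d) / N) (u := (a ^ 2 + b ^ 2 - c ^ 2 - d ^ 2) / N) (by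
      field_simp
      rw [hNdef]
      ring)
  obtain ⟨e, hex, hey, heu⟩ := exists_pillow_eq hx hy hu
  have her : pillowR e = l := by
    rw [pillowR, hex, hey, heu]
    rw [Real.sqrt_eq_iff_mul_self_eq_of_pos hl]
    field_simp
    rw [hNdef]
    ring
  refine ⟨e, ?_⟩
  unfold torusCoord
  split_ifs <;>
    simp only [northCoord, southCoord, hex, hey, heu, her] <;> apply Complex.ext <;>
    simp only [Complex.mul_re, Complex.mul_im, Complex.ofReal_re, Complex.ofReal_im] <;>
    field_simp <;> rw [hNdef] <;> ring

lemma hopf_torusCoord (e : Circle × Circle) :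
    (torusCoord e).1 * star (torusCoord e).2 * (2 * pillowR e) =
      (⟨pillowX e, pillowY e⟩ : ℂ) * ((torusCoord e).1 * star (torusCoord e).1 +
        (torusCoord e).2 * star (torusCoord e).2) ∧
    ((torusCoord e).1 * star (torusCoord e).1 - (torusCoord e).2 * star (torusCoord e).2) *
      pillowR e = pillowU e * ((torusCoord e).1 * star (torusCoord e).1 +
        (torusCoord e).2 * star (torusCoord e).2) := by
  have h := pillowR_sq e
  have hs : star (⟨pillowX e, pillowY e⟩ : ℂ) = ⟨pillowX e, -pillowY e⟩ := rfl
  have hs' : star (⟨pillowX e, -pillowY e⟩ : ℂ) = ⟨pillowX e, pillowY e⟩ := by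
    rw [← hs, star_star]
  have hr (t : ℝ) : star (t : ℂ) = t := Complex.conj_ofReal t
  have hz : (⟨pillowX e, pillowY e⟩ : ℂ) * ⟨pillowX e, -pillowY e⟩ =
      (pillowR e : ℂ) ^ 2 - (pillowU e : ℂ) ^ 2 := by
    rw [← Complex.ofReal_pow, ← Complex.ofReal_pow, h]
    apply Complex.ext
    · simp [-Complex.ofReal_pow]
      ring
    · simp [-Complex.ofReal_pow]
      ring
  unfold torusCoord
  split_ifs
  · simp only [northCoord, hs, hr]
    simp only [Complex.ofReal_sub]
    exact ⟨by linear_combination (-⟨pillowX e, pillowY e⟩ : ℂ) * hz,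
      by linear_combination ((pillowR e : ℂ) - pillowU e) * hz⟩
  · simp only [southCoord, hs', hr]
    simp only [Complex.ofReal_add]
    exact ⟨by linear_combination (-⟨pillowX e, pillowY e⟩ : ℂ) * hz,
      by linear_combination -((pillowR e : ℂ) + pillowU e) * hz⟩

lemma eq_or_eq_inv_of_torusCoord_cross {e f : Circle × Circle}
    (h : (torusCoord e).1 * (torusCoord f).2 = (torusCoord e).2 * (torusCoord f).1) :
    e = f ∨ e = f⁻¹ := by
  obtain ⟨c, hc, hcf⟩ := exists_smul_of_cross (torusCoord_ne_zero e) (torusCoord_ne_zero f) h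
  obtain ⟨he1, he2⟩ := hopf_torusCoord e
  obtain ⟨hf1, hf2⟩ := hopf_torusCoord f
  have hN : (torusCoord e).1 * star (torusCoord e).1 +
      (torusCoord e).2 * star (torusCoord e).2 ≠ 0 := by
    intro h0
    have h1 : ((Complex.normSq (torusCoord e).1 + Complex.normSq (torusCoord e).2 : ℝ) : ℂ) = 0 := by
      rw [Complex.ofReal_add, ← Complex.mul_conj, ← Complex.mul_conj]
      exact h0
    have h2 := Complex.ofReal_eq_zero.1 h1
    have h3 := Complex.normSq_nonneg (torusCoord e).1
    have h4 := Complex.normSq_nonneg (torusCoord e).2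
    exact torusCoord_ne_zero e (Prod.ext (Complex.normSq_eq_zero.1 (by linarith))
      (Complex.normSq_eq_zero.1 (by linarith)))
  have hcc : c * star c ≠ 0 := mul_ne_zero hc (star_ne_zero.2 hc)
  rw [hcf] at hf1 hf2
  simp only [Prod.smul_fst, Prod.smul_snd, smul_eq_mul, star_mul'] at hf1 hf2
  generalize torusCoord e = p at *
  have hz : (⟨pillowX f, pillowY f⟩ : ℂ) * pillowR e = ⟨pillowX e, pillowY e⟩ * pillowR f := by
    refine mul_left_cancel₀ (mul_ne_zero hcc hN) ?_
    linear_combination (c * star c * pillowR f) * he1 - pillowR e * hf1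
  have hu : (pillowU f : ℂ) * pillowR e = pillowU e * pillowR f := by
    refine mul_left_cancel₀ (mul_ne_zero hcc hN) ?_
    linear_combination (c * star c * pillowR f) * he2 - pillowR e * hf2
  have hx := congrArg Complex.re hz
  have hy := congrArg Complex.im hz
  simp at hx hy
  have hu' : pillowU f * pillowR e = pillowU e * pillowR f := by exact_mod_cast hu
  have her := pillowR_pos e
  have hfr := pillowR_pos f
  have ex : pillowX e = pillowR e / pillowR f * pillowX f := by field_simp; linarith
  have ey : pillowY e = pillowR e / pillowR f * pillowY f := by field_simp; linarith
  have eu : pillowU e = pillowR e / pillowR f * pillowU f := by field_simp; linarith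
  obtain ⟨f1, f2, f3⟩ := pillow_bounds f
  obtain ⟨e1, e2, e3⟩ := pillow_bounds e
  have hl : pillowR e / pillowR f = 1 :=
    pillow_scale_unique (by positivity) f1 f2 f3 (by rwa [← ex]) (by rwa [← ey])
      (by rw [← ex, ← ey, ← eu]; exact e3)
  rw [hl, one_mul] at ex ey eu
  exact eq_or_eq_inv_of_pillow_eq ex ey eu

/-- The point of projective space given by the product of nonzero linear polynomials. -/
noncomputable def prodPt {n : ℕ} (L : {L : Fin n → ℂ × ℂ // ∀ i, L i ≠ 0}) :
    Projectivization ℂ (Fin (n + 1) → ℂ) :=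
  Projectivization.mk' ℂ ⟨prodCoeff L.1, prodCoeff_ne_zero L.2⟩

lemma continuous_prodPt (n : ℕ) : Continuous (prodPt (n := n)) :=
  (continuous_projMk _).comp
    (((continuous_prodCoeff n).comp continuous_subtype_val).subtype_mk _)

lemma prodPt_eq_of_cross {n : ℕ} {L L' : {L : Fin n → ℂ × ℂ // ∀ i, L i ≠ 0}}
    (h : ∀ i, (L.1 i).1 * (L'.1 i).2 = (L.1 i).2 * (L'.1 i).1) : prodPt L = prodPt L' := by
  choose c hc h' using fun i => exists_smul_of_cross (L.2 i) (L'.2 i) (h i)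
  symm
  refine (Projectivization.mk_eq_mk_iff' _ _ _ _ _).2 ⟨∏ i, c i, ?_⟩
  rw [← prodCoeff_smul]
  exact congrArg prodCoeff (funext fun i => (h' i).symm)

/-- The map from the `n`-th power of the two-dimensional torus to complex projective
`n`-space, obtained from the double cover of the projective line by the torus and the
identification of projective `n`-space with the symmetric power of the line. -/
noncomputable def torusToProj (n : ℕ) (e : Fin n → Circle × Circle) :
    Projectivization ℂ (Fin (n + 1) → ℂ) :=
  prodPt ⟨fun i => torusCoord (e i), fun i => torusCoord_ne_zero (e i)⟩

lemma exists_local_torusCoord (e₀ : Circle × Circle) :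
    ∃ c : Circle × Circle → ℂ × ℂ, Continuous c ∧ c e₀ ≠ 0 ∧
      ∀ e, (torusCoord e).1 * (c e).2 = (torusCoord e).2 * (c e).1 := by
  rcases le_total (pillowU e₀) 0 with h | h
  · exact ⟨northCoord, continuous_northCoord, northCoord_ne_zero h, torusCoord_cross_north⟩
  · exact ⟨southCoord, continuous_southCoord, southCoord_ne_zero h, torusCoord_cross_south⟩

lemma continuous_torusToProj (n : ℕ) : Continuous (torusToProj n) := by
  rw [continuous_iff_continuousAt]
  intro e₀
  choose c hc hc0 hcc using fun i => exists_local_torusCoord (e₀ i)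
  set U : Set (Fin n → Circle × Circle) := {e | ∀ i, c i (e i) ≠ 0} with hU
  have hUo : IsOpen U := by
    rw [hU, Set.ofPred_forall]
    exact isOpen_iInter_of_finite fun i =>
      isOpen_ne_fun ((hc i).comp (continuous_apply i)) continuous_const
  have hon : ContinuousOn (torusToProj n) U := by
    rw [continuousOn_iff_continuous_domRestrict]
    have : U.domRestrict (torusToProj n) =
        fun e : U => prodPt ⟨fun i => c i (e.1 i), e.2⟩ :=
      funext fun e => prodPt_eq_of_cross fun i => hcc i (e.1 i)
    rw [this]
    refine (continuous_prodPt n).comp (Continuous.subtype_mk (continuous_pi fun i => ?_) _)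
    exact (hc i).comp ((continuous_apply i).comp continuous_subtype_val)
  exact hon.continuousAt (hUo.mem_nhds hc0)

lemma torusToProj_eq_iff {n : ℕ} {e f : Fin n → Circle × Circle} :
    torusToProj n e = torusToProj n f ↔
      ∃ σ : Equiv.Perm (Fin n), ∀ i, f i = e (σ i) ∨ f i = (e (σ i))⁻¹ := by
  constructor
  · intro h
    obtain ⟨c, hc⟩ := (Projectivization.mk_eq_mk_iff' _ _ _ _ _).1 h.symm
    obtain ⟨σ, hσ⟩ := exists_perm_of_prodCoeff (fun i => torusCoord_ne_zero (e i))
      (fun i => torusCoord_ne_zero (f i)) hc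
    refine ⟨σ, fun i => ?_⟩
    rcases eq_or_eq_inv_of_torusCoord_cross (hσ i) with h | h
    · exact Or.inl h.symm
    · exact Or.inr (by rw [h, inv_inv])
  · rintro ⟨σ, hσ⟩
    have hf (i : Fin n) : torusCoord (f i) = torusCoord (e (σ i)) := by
      rcases hσ i with h | h <;> simp [h, torusCoord_inv]
    unfold torusToProj prodPt
    congr 2
    simp only [hf]
    exact (prodCoeff_perm (fun i => torusCoord (e i)) σ).symm

lemma torusToProj_surjective (n : ℕ) : Function.Surjective (torusToProj n) := by
  intro p
  induction p with | h v hv => ?_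
  obtain ⟨c, L, hL, rfl⟩ := exists_smul_prodCoeff hv
  choose e he using fun i => exists_torusCoord_cross (hL i)
  refine ⟨e, ?_⟩
  have : torusToProj n e = prodPt ⟨L, hL⟩ := prodPt_eq_of_cross he
  rw [this]
  symm
  exact (Projectivization.mk_eq_mk_iff' _ _ _ _ _).2 ⟨c, rfl⟩

lemma isQuotientMap_torusToProj (n : ℕ) : Topology.IsQuotientMap (torusToProj n) :=
  (continuous_torusToProj n).isClosedMap.isQuotientMap (continuous_torusToProj n)
    (torusToProj_surjective n)

section SymplecticEigenbasis

variable {V : Type*} [AddCommGroup V] [Module ℂ V]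

/-- A simultaneous eigenvector (possibly zero) of two endomorphisms. -/
def IsJointEigen (A B : Module.End ℂ V) (x : V) : Prop :=
  (∃ a : ℂ, A x = a • x) ∧ ∃ b : ℂ, B x = b • x

lemma span_isJointEigen_eq_top [FiniteDimensional ℂ V] {A B : Module.End ℂ V}
    (hAB : ∀ x, A (B x) = B (A x)) (hA : ⨆ μ, A.eigenspace μ = ⊤) (hB : ⨆ μ, B.eigenspace μ = ⊤) :
    Submodule.span ℂ {x | IsJointEigen A B x} = ⊤ := by
  rw [eq_top_iff, ← hA]
  refine iSup_le fun μ => ?_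
  have h := Submodule.inf_iSup_genEigenspace (p := A.eigenspace μ) (f := B) (fun x hx => by
    rw [Module.End.mem_eigenspace_iff] at hx ⊢
    rw [hAB, hx, map_smul]) 1
  have hB' : ⨆ ν, B.genEigenspace ν 1 = ⊤ := hB
  rw [hB', inf_top_eq] at h
  rw [h]
  refine iSup_le fun ν x hx => Submodule.subset_span ?_
  exact ⟨⟨μ, Module.End.mem_eigenspace_iff.1 hx.1⟩, ⟨ν, Module.End.mem_eigenspace_iff.1 hx.2⟩⟩

/-- The component of `x` orthogonal to a symplectic family. -/
def symplecticResidue (ω : LinearMap.BilinForm ℂ V) {k : ℕ} (v w : Fin k → V) (x : V) : V :=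
  x - ∑ i, ω x (w i) • v i + ∑ i, ω x (v i) • w i

/-- The relations satisfied by a (partial) symplectic basis. -/
structure IsSymplecticFamily (ω : LinearMap.BilinForm ℂ V) {k : ℕ} (v w : Fin k → V) : Prop where
  left : ∀ i j, ω (v i) (v j) = 0
  right : ∀ i j, ω (w i) (w j) = 0
  pairing : ∀ i j, ω (v i) (w j) = if i = j then 1 else 0

variable {ω : LinearMap.BilinForm ℂ V} {k : ℕ} {v w : Fin k → V}

lemma residue_orthogonal_left (hω : ω.IsAlt) (h : IsSymplecticFamily ω v w) (x : V) (j : Fin k) :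
    ω (symplecticResidue ω v w x) (v j) = 0 := by
  have hp (i : Fin k) : ω (w i) (v j) = -(if i = j then 1 else 0) := by
    rw [← hω.neg_eq, h.pairing]
    simp only [eq_comm]
  simp [symplecticResidue, h.left, hp]

lemma residue_orthogonal_right (h : IsSymplecticFamily ω v w) (x : V) (j : Fin k) :
    ω (symplecticResidue ω v w x) (w j) = 0 := by
  simp [symplecticResidue, h.right, h.pairing]

lemma apply_residue_of_orthogonal {z : V} (hv : ∀ i, ω z (v i) = 0) (hw : ∀ i, ω z (w i) = 0)
    (y : V) : ω z (symplecticResidue ω v w y) = ω z y := by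
  simp [symplecticResidue, hv, hw]

lemma eigenvalue_transfer {A : Module.End ℂ V} (hA : ∀ x y, ω (A x) (A y) = ω x y) {x y : V}
    {a b c : ℂ} (hx : A x = a • x) (hy : A y = b • y) (hbc : b * c = 1) :
    ω x y * c = a * ω x y := by
  have := hA x y
  rw [hx, hy] at this
  simp only [map_smul, LinearMap.smul_apply, smul_eq_mul] at this
  linear_combination -c * this + a * ω x y * hbc

lemma eigenvalue_mul_of_pairing {A : Module.End ℂ V} (hA : ∀ x y, ω (A x) (A y) = ω x y) {x y : V}
    {a b : ℂ} (hx : A x = a • x) (hy : A y = b • y) (hxy : ω x y ≠ 0) : a * b = 1 := by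
  have := hA x y
  rw [hx, hy] at this
  simp only [map_smul, LinearMap.smul_apply, smul_eq_mul] at this
  refine mul_right_cancel₀ hxy ?_
  linear_combination this

lemma residue_eigen {A : Module.End ℂ V} (hA : ∀ x y, ω (A x) (A y) = ω x y)
    (h : IsSymplecticFamily ω v w) (hv : ∀ i, ∃ a : ℂ, A (v i) = a • v i)
    (hw : ∀ i, ∃ a : ℂ, A (w i) = a • w i) {x : V} {a : ℂ} (hx : A x = a • x) :
    A (symplecticResidue ω v w x) = a • symplecticResidue ω v w x := by
  choose α hα using hv
  choose β hβ using hw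
  have hαβ (i : Fin k) : α i * β i = 1 :=
    eigenvalue_mul_of_pairing hA (hα i) (hβ i) (by simp [h.pairing])
  simp only [symplecticResidue, map_add, map_sub, map_sum, map_smul, hx, hα, hβ, smul_add,
    smul_sub, Finset.smul_sum, smul_smul]
  congr 1
  · congr 1
    refine Finset.sum_congr rfl fun i _ => ?_
    rw [eigenvalue_transfer hA hx (hβ i) (by rw [mul_comm, hαβ])]
  · refine Finset.sum_congr rfl fun i _ => ?_
    rw [eigenvalue_transfer hA hx (hα i) (hαβ i)]

lemma IsSymplecticFamily.cons (hω : ω.IsAlt) (h : IsSymplecticFamily ω v w) {x y : V}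
    (hxv : ∀ i, ω x (v i) = 0) (hxw : ∀ i, ω x (w i) = 0) (hyv : ∀ i, ω y (v i) = 0)
    (hyw : ∀ i, ω y (w i) = 0) (hxy : ω x y = 1) :
    IsSymplecticFamily ω (Fin.cons x v : Fin (k + 1) → V) (Fin.cons y w : Fin (k + 1) → V) := by
  have hvx (i : Fin k) : ω (v i) x = 0 := by rw [← hω.neg_eq, hxv, neg_zero]
  have hvy (i : Fin k) : ω (v i) y = 0 := by rw [← hω.neg_eq, hyv, neg_zero]
  have hwy (i : Fin k) : ω (w i) y = 0 := by rw [← hω.neg_eq, hyw, neg_zero]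
  constructor
  · intro i j
    refine Fin.cases ?_ (fun i => ?_) i <;> refine Fin.cases ?_ (fun j => ?_) j <;>
      simp [h.left, hxv, hvx, hω.self_eq_zero]
  · intro i j
    refine Fin.cases ?_ (fun i => ?_) i <;> refine Fin.cases ?_ (fun j => ?_) j <;>
      simp [h.right, hyw, hwy, hω.self_eq_zero]
  · intro i j
    refine Fin.cases ?_ (fun i => ?_) i <;> refine Fin.cases ?_ (fun j => ?_) j <;>
      simp [h.pairing, hxw, hvy, hxy, Fin.succ_ne_zero, (Fin.succ_ne_zero _).symm]

/-- Two commuting diagonalizable symplectic endomorphisms have a common symplectic eigenbasis. -/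
lemma exists_symplectic_eigenfamily [FiniteDimensional ℂ V] {A B : Module.End ℂ V} {n : ℕ}
    (hn : Module.finrank ℂ V = 2 * n) (hω : ω.IsAlt) (hnd : ∀ x, (∀ y, ω x y = 0) → x = 0)
    (hA : ∀ x y, ω (A x) (A y) = ω x y) (hB : ∀ x y, ω (B x) (B y) = ω x y)
    (hspan : Submodule.span ℂ {x | IsJointEigen A B x} = ⊤) (k : ℕ) (hk : k ≤ n) :
    ∃ v w : Fin k → V, IsSymplecticFamily ω v w ∧ (∀ i, IsJointEigen A B (v i)) ∧
      ∀ i, IsJointEigen A B (w i) := by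
  induction k with
  | zero =>
    exact ⟨Fin.elim0, Fin.elim0, ⟨fun i => i.elim0, fun i => i.elim0, fun i => i.elim0⟩,
      fun i => i.elim0, fun i => i.elim0⟩
  | succ k ih =>
    obtain ⟨v, w, h, hv, hw⟩ := ih (by omega)
    have hres {x : V} (hx : IsJointEigen A B x) :
        IsJointEigen A B (symplecticResidue ω v w x) := by
      obtain ⟨⟨a, ha⟩, b, hb⟩ := hx
      exact ⟨⟨a, residue_eigen hA h (fun i => (hv i).1) (fun i => (hw i).1) ha⟩,
        b, residue_eigen hB h (fun i => (hv i).2) (fun i => (hw i).2) hb⟩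
    obtain ⟨x, hx, hx0⟩ : ∃ x, IsJointEigen A B x ∧ symplecticResidue ω v w x ≠ 0 := by
      by_contra! hall
      have hle : Submodule.span ℂ {x | IsJointEigen A B x} ≤
          Submodule.span ℂ (Set.range (Sum.elim v w)) := by
        refine Submodule.span_le.2 fun x hx => ?_
        have h0 := hall x hx
        have hxe : x = ∑ i, ω x (w i) • v i - ∑ i, ω x (v i) • w i := by
          rw [symplecticResidue, sub_add, sub_eq_zero] at h0
          exact h0
        rw [hxe]
        exact Submodule.sub_mem _
          (Submodule.sum_mem _ fun i _ => Submodule.smul_mem _ _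
            (Submodule.subset_span ⟨Sum.inl i, rfl⟩))
          (Submodule.sum_mem _ fun i _ => Submodule.smul_mem _ _
            (Submodule.subset_span ⟨Sum.inr i, rfl⟩))
      rw [hspan, top_le_iff] at hle
      have hcard := finrank_range_le_card (R := ℂ) (Sum.elim v w)
      rw [Set.finrank, hle, finrank_top, hn] at hcard
      simp at hcard
      omega
    set x' := symplecticResidue ω v w x with hx'
    have hxv := residue_orthogonal_left hω h x
    have hxw := residue_orthogonal_right h x
    obtain ⟨y, hy, hy0⟩ : ∃ y, IsJointEigen A B y ∧ ω x' y ≠ 0 := by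
      by_contra! hall
      refine hx0 (hnd x' fun y => ?_)
      have hy : y ∈ Submodule.span ℂ {x | IsJointEigen A B x} := hspan ▸ Submodule.mem_top
      have hle : Submodule.span ℂ {x | IsJointEigen A B x} ≤ LinearMap.ker (ω x') :=
        Submodule.span_le.2 fun y hy => hall y hy
      exact hle hy
    rw [← apply_residue_of_orthogonal hxv hxw] at hy0
    set y' := symplecticResidue ω v w y with hy'
    refine ⟨Fin.cons x' v, Fin.cons ((ω x' y')⁻¹ • y') w,
      h.cons hω hxv hxw (fun i => ?_) (fun i => ?_) ?_, fun i => ?_, fun i => ?_⟩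
    · rw [map_smul, LinearMap.smul_apply, residue_orthogonal_left hω h, smul_zero]
    · rw [map_smul, LinearMap.smul_apply, residue_orthogonal_right h, smul_zero]
    · rw [map_smul, smul_eq_mul, inv_mul_cancel₀ hy0]
    · refine Fin.cases (hres hx) (fun i => hv i) i
    · refine Fin.cases ?_ (fun i => hw i) i
      obtain ⟨⟨a, ha⟩, b, hb⟩ := hres hy
      refine ⟨⟨a, ?_⟩, b, ?_⟩
      · rw [Fin.cons_zero, map_smul, ha, smul_comm]
      · rw [Fin.cons_zero, map_smul, hb, smul_comm]

end SymplecticEigenbasis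

/-- The identification of the index set of `2n × 2n` matrices with two copies of `Fin n`. -/
def idx (n : ℕ) : Fin n ⊕ Fin n ≃ Fin (2 * n) :=
  finSumFinEquiv.trans (finCongr (two_mul n).symm)

lemma Jstd_eq_submatrix (n : ℕ) :
    Jstd n = (Matrix.J (Fin n) ℂ).submatrix (idx n).symm (idx n).symm := rfl

lemma Jstd_idx {n : ℕ} (p q : Fin n ⊕ Fin n) :
    Jstd n (idx n p) (idx n q) = Matrix.J (Fin n) ℂ p q := by
  simp [Jstd_eq_submatrix]

lemma Jstd_mul_Jstd (n : ℕ) : Jstd n * Jstd n = -1 := by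
  rw [Jstd_eq_submatrix, Matrix.submatrix_mul_equiv, Matrix.J_squared]
  change -((1 : Matrix (Fin n ⊕ Fin n) (Fin n ⊕ Fin n) ℂ).submatrix _ _) = -1
  rw [Matrix.submatrix_one_equiv]

lemma Jstd_transpose (n : ℕ) : (Jstd n)ᵀ = -Jstd n := by
  rw [Jstd_eq_submatrix, Matrix.transpose_submatrix, Matrix.J_transpose, Matrix.submatrix_neg]
  rfl

lemma inverse_of_symplectic {n : ℕ} {M : Matrix (Fin (2 * n)) (Fin (2 * n)) ℂ}
    (h : Mᵀ * Jstd n * M = Jstd n) :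
    M * (-Jstd n * Mᵀ * Jstd n) = 1 ∧ (-Jstd n * Mᵀ * Jstd n) * M = 1 := by
  have h1 : (-Jstd n * Mᵀ * Jstd n) * M = 1 := by
    rw [Matrix.mul_assoc, Matrix.mul_assoc, ← Matrix.mul_assoc Mᵀ, h, neg_mul, Jstd_mul_Jstd,
      neg_neg]
  exact ⟨mul_eq_one_comm.1 h1, h1⟩

lemma mem_Spset_of_symplectic {n : ℕ} {M : Matrix (Fin (2 * n)) (Fin (2 * n)) ℂ}
    (h : Mᵀ * Jstd n * M = Jstd n) : M ∈ Spset n :=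
  ⟨IsUnit.of_mul_eq_one _ (inverse_of_symplectic h).1, h⟩

lemma inverse_mem_Spset {n : ℕ} {M N : Matrix (Fin (2 * n)) (Fin (2 * n)) ℂ}
    (h : Mᵀ * Jstd n * M = Jstd n) (hMN : M * N = 1) : N ∈ Spset n := by
  refine mem_Spset_of_symplectic ?_
  have : Nᵀ * (Mᵀ * Jstd n * M) * N = Jstd n := by
    calc Nᵀ * (Mᵀ * Jstd n * M) * N = (M * N)ᵀ * Jstd n * (M * N) := by
          rw [Matrix.transpose_mul]
          simp only [Matrix.mul_assoc]
      _ = Jstd n := by rw [hMN]; simp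
  rwa [h] at this

/-- The standard symplectic bilinear form. -/
noncomputable def stdForm (n : ℕ) : LinearMap.BilinForm ℂ (Fin (2 * n) → ℂ) :=
  Matrix.toBilin' (Jstd n)

lemma stdForm_apply {n : ℕ} (x y : Fin (2 * n) → ℂ) :
    stdForm n x y = x ⬝ᵥ Jstd n *ᵥ y := Matrix.toBilin'_apply' _ _ _

lemma stdForm_isAlt (n : ℕ) : (stdForm n).IsAlt := by
  intro x
  have h : stdForm n x x = -stdForm n x x := by
    conv_lhs => rw [stdForm_apply, Matrix.dotProduct_mulVec, ← Matrix.mulVec_transpose,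
      Jstd_transpose, Matrix.neg_mulVec, neg_dotProduct, dotProduct_comm, ← stdForm_apply]
  linear_combination h / 2

lemma stdForm_nondegenerate {n : ℕ} (x : Fin (2 * n) → ℂ) (h : ∀ y, stdForm n x y = 0) :
    x = 0 := by
  funext i
  have := h (Jstd n *ᵥ Pi.single i 1)
  rw [stdForm_apply, Matrix.mulVec_mulVec, Jstd_mul_Jstd, Matrix.neg_mulVec,
    Matrix.one_mulVec, dotProduct_neg, dotProduct_single, mul_one] at this
  simpa using this

lemma stdForm_mulVec {n : ℕ} {A : Matrix (Fin (2 * n)) (Fin (2 * n)) ℂ} (hA : A ∈ Spset n)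
    (x y : Fin (2 * n) → ℂ) : stdForm n (A *ᵥ x) (A *ᵥ y) = stdForm n x y := by
  rw [stdForm_apply, stdForm_apply, Matrix.mulVec_mulVec, ← Matrix.vecMul_transpose,
    ← Matrix.dotProduct_mulVec, Matrix.mulVec_mulVec, ← Matrix.mul_assoc, hA.2]

lemma iSup_eigenspace_eq_top {m : ℕ} {A : Matrix (Fin m) (Fin m) ℂ} (hA : IsSemisimpleMat A) :
    ⨆ μ, Module.End.eigenspace (Matrix.toLin' A) μ = ⊤ := by
  obtain ⟨P, Q, hPQ, hQP, hD⟩ := hA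
  have hAP : A * P = P * (Q * A * P) := by
    rw [← Matrix.mul_assoc, ← Matrix.mul_assoc, hPQ, Matrix.one_mul]
  have hcol (k : Fin m) : P.col k ∈ ⨆ μ, Module.End.eigenspace (Matrix.toLin' A) μ := by
    refine Submodule.mem_iSup_of_mem ((Q * A * P) k k) ?_
    rw [Module.End.mem_eigenspace_iff]
    funext i
    have hdiag : (P * (Q * A * P)) i k = P i k * (Q * A * P) k k := by
      rw [Matrix.mul_apply]
      exact Finset.sum_eq_single k (fun j _ hj => by rw [hD hj, mul_zero]) (by simp)
    rw [Pi.smul_apply, smul_eq_mul, Matrix.col_apply, mul_comm, ← hdiag, ← hAP, Matrix.mul_apply]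
    rfl
  rw [eq_top_iff]
  intro x _
  have hx : x = ∑ k, (Q *ᵥ x) k • P.col k := by
    conv_lhs => rw [← Matrix.one_mulVec x, ← hPQ, ← Matrix.mulVec_mulVec]
    funext i
    simp [Matrix.mulVec, dotProduct, mul_comm]
  rw [hx]
  exact Submodule.sum_mem _ fun k _ => Submodule.smul_mem _ _ (hcol k)

/-- The diagonal entries of an element of the standard maximal torus of `Sp(2n,ℂ)`. -/
def torusEntries {n : ℕ} (a : Fin n → ℂˣ) (p : Fin n ⊕ Fin n) : ℂ :=
  Sum.elim (fun i => (a i : ℂ)) (fun i => ((a i)⁻¹ : ℂˣ)) p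

/-- The standard maximal torus of `Sp(2n,ℂ)`. -/
def torusMat {n : ℕ} (a : Fin n → ℂˣ) : Matrix (Fin (2 * n)) (Fin (2 * n)) ℂ :=
  Matrix.diagonal fun k => torusEntries a ((idx n).symm k)

lemma torusMat_mem_Spset {n : ℕ} (a : Fin n → ℂˣ) : torusMat a ∈ Spset n := by
  refine mem_Spset_of_symplectic ?_
  ext k l
  obtain ⟨p, rfl⟩ := (idx n).surjective k
  obtain ⟨q, rfl⟩ := (idx n).surjective l
  rw [torusMat, Matrix.diagonal_transpose, Matrix.mul_diagonal, Matrix.diagonal_mul, Jstd_idx]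
  simp only [Equiv.symm_apply_apply]
  rcases p with i | i <;> rcases q with j | j <;>
    simp [Matrix.J, torusEntries, Matrix.one_apply]
  all_goals
    split_ifs with h
    · simp [h]
    · rfl

/-- Pairs of points of the standard maximal torus. -/
def torusPair {n : ℕ} (e : Fin n → ℂˣ × ℂˣ) : Fin 2 → Matrix (Fin (2 * n)) (Fin (2 * n)) ℂ :=
  ![torusMat fun i => (e i).1, torusMat fun i => (e i).2]

lemma torusPair_mem {n : ℕ} (e : Fin n → ℂˣ × ℂˣ) : torusPair e ∈ ssTuples 2 (Spset n) := by
  have hd (i : Fin 2) : ∃ d, torusPair e i = Matrix.diagonal d := by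
    fin_cases i
    · exact ⟨_, rfl⟩
    · exact ⟨_, rfl⟩
  refine ⟨⟨fun i => ?_, fun i j => ?_⟩, fun i => ?_⟩
  · fin_cases i
    · exact torusMat_mem_Spset _
    · exact torusMat_mem_Spset _
  · obtain ⟨d, hd1⟩ := hd i
    obtain ⟨d', hd2⟩ := hd j
    rw [hd1, hd2, Matrix.diagonal_mul_diagonal, Matrix.diagonal_mul_diagonal]
    simp only [mul_comm]
  · obtain ⟨d, hd1⟩ := hd i
    refine ⟨1, 1, by simp, by simp, ?_⟩
    rw [hd1]
    simp [Matrix.isDiag_diagonal]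

/-- The matrix whose columns are two families of vectors. -/
def columnMatrix {n : ℕ} (v w : Fin n → Fin (2 * n) → ℂ) :
    Matrix (Fin (2 * n)) (Fin (2 * n)) ℂ :=
  Matrix.of fun k l => Sum.elim v w ((idx n).symm l) k

lemma columnMatrix_symplectic {n : ℕ} {v w : Fin n → Fin (2 * n) → ℂ}
    (hv : ∀ i j, stdForm n (v i) (v j) = 0) (hw : ∀ i j, stdForm n (w i) (w j) = 0)
    (hvw : ∀ i j, stdForm n (v i) (w j) = if i = j then -1 else 0) :
    (columnMatrix v w)ᵀ * Jstd n * columnMatrix v w = Jstd n := by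
  have hwv (i j : Fin n) : stdForm n (w i) (v j) = if i = j then 1 else 0 := by
    rw [← (stdForm_isAlt n).neg_eq, hvw]
    split_ifs with h1 h2 h2 <;> simp_all
  ext k l
  obtain ⟨p, rfl⟩ := (idx n).surjective k
  obtain ⟨q, rfl⟩ := (idx n).surjective l
  have h : ((columnMatrix v w)ᵀ * Jstd n * columnMatrix v w) (idx n p) (idx n q) =
      stdForm n (Sum.elim v w p) (Sum.elim v w q) := by
    rw [stdForm_apply, Matrix.mul_assoc, Matrix.mul_apply]
    refine Finset.sum_congr rfl fun k _ => ?_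
    rw [Matrix.transpose_apply, Matrix.mul_apply]
    simp [columnMatrix, Matrix.mulVec, dotProduct]
  rw [h, Jstd_idx]
  rcases p with i | i <;> rcases q with j | j <;>
    simp only [Sum.elim_inl, Sum.elim_inr, hv, hw, hvw, hwv, Matrix.J, Matrix.fromBlocks_apply₁₁,
      Matrix.fromBlocks_apply₁₂, Matrix.fromBlocks_apply₂₁, Matrix.fromBlocks_apply₂₂,
      Matrix.zero_apply, Matrix.neg_apply, Matrix.one_apply]
  split_ifs <;> simp

lemma mul_columnMatrix {n : ℕ} {A : Matrix (Fin (2 * n)) (Fin (2 * n)) ℂ} {a : Fin n → ℂˣ}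
    {v w : Fin n → Fin (2 * n) → ℂ} (hv : ∀ i, A *ᵥ v i = (a i : ℂ) • v i)
    (hw : ∀ i, A *ᵥ w i = ((a i)⁻¹ : ℂˣ).val • w i) :
    A * columnMatrix v w = columnMatrix v w * torusMat a := by
  ext k l
  obtain ⟨p, rfl⟩ := (idx n).surjective l
  have h : (A * columnMatrix v w) k (idx n p) = (A *ᵥ Sum.elim v w p) k := by
    simp [Matrix.mul_apply, Matrix.mulVec, dotProduct, columnMatrix]
  rw [h, torusMat, Matrix.mul_diagonal]
  rcases p with i | i
  · simp [columnMatrix, torusEntries, hv, mul_comm]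
  · simp [columnMatrix, torusEntries, hw, mul_comm]

/-- A common symplectic eigenbasis of a pair conjugates it into the standard torus. -/
lemma conjRel_of_eigenbasis {n : ℕ} {f : ssTuples 2 (Spset n)} {e : Fin n → ℂˣ × ℂˣ}
    {v w : Fin n → Fin (2 * n) → ℂ}
    (hv : ∀ i j, stdForm n (v i) (v j) = 0) (hw : ∀ i j, stdForm n (w i) (w j) = 0)
    (hvw : ∀ i j, stdForm n (v i) (w j) = if i = j then -1 else 0)
    (hv0 : ∀ i, f.1 0 *ᵥ v i = ((e i).1 : ℂ) • v i)
    (hw0 : ∀ i, f.1 0 *ᵥ w i = ((e i).1⁻¹ : ℂˣ).val • w i)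
    (hv1 : ∀ i, f.1 1 *ᵥ v i = ((e i).2 : ℂ) • v i)
    (hw1 : ∀ i, f.1 1 *ᵥ w i = ((e i).2⁻¹ : ℂˣ).val • w i) :
    conjRel (Spset n) (ssTuples 2 (Spset n)) ⟨torusPair e, torusPair_mem e⟩ f := by
  have hM := columnMatrix_symplectic hv hw hvw
  obtain ⟨h1, h2⟩ := inverse_of_symplectic hM
  refine ⟨_, _, mem_Spset_of_symplectic hM, inverse_mem_Spset hM h1, h1, h2, fun i => ?_⟩
  fin_cases i
  · change columnMatrix v w * torusMat (fun i => (e i).1) * _ = f.1 0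
    rw [← mul_columnMatrix hv0 hw0, Matrix.mul_assoc, h1, Matrix.mul_one]
  · change columnMatrix v w * torusMat (fun i => (e i).2) * _ = f.1 1
    rw [← mul_columnMatrix hv1 hw1, Matrix.mul_assoc, h1, Matrix.mul_one]

/-- Every pair of commuting semisimple symplectic matrices is conjugate into the torus. -/
lemma exists_conjRel_torusPair {n : ℕ} (f : ssTuples 2 (Spset n)) :
    ∃ e, conjRel (Spset n) (ssTuples 2 (Spset n)) ⟨torusPair e, torusPair_mem e⟩ f := by
  obtain ⟨⟨hSp, hcomm⟩, hss⟩ := f.2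
  have hspan := span_isJointEigen_eq_top (A := Matrix.toLin' (f.1 0)) (B := Matrix.toLin' (f.1 1))
    (fun x => by simp only [Matrix.toLin'_apply, Matrix.mulVec_mulVec, hcomm 0 1])
    (iSup_eigenspace_eq_top (hss 0)) (iSup_eigenspace_eq_top (hss 1))
  have h0 (x y) : stdForm n (Matrix.toLin' (f.1 0) x) (Matrix.toLin' (f.1 0) y) = stdForm n x y :=
    stdForm_mulVec (hSp 0) x y
  have h1 (x y) : stdForm n (Matrix.toLin' (f.1 1) x) (Matrix.toLin' (f.1 1) y) = stdForm n x y :=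
    stdForm_mulVec (hSp 1) x y
  obtain ⟨v, w, h, hv, hw⟩ := exists_symplectic_eigenfamily (n := n) (by simp) (stdForm_isAlt n)
    stdForm_nondegenerate h0 h1 hspan n le_rfl
  choose a ha using fun i => (hv i).1
  choose b hb using fun i => (hv i).2
  choose a' ha' using fun i => (hw i).1
  choose b' hb' using fun i => (hw i).2
  have haa (i : Fin n) : a' i * a i = 1 := by
    rw [mul_comm]
    exact eigenvalue_mul_of_pairing h0 (ha i) (ha' i) (by simp [h.pairing])
  have hbb (i : Fin n) : b' i * b i = 1 := by
    rw [mul_comm]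
    exact eigenvalue_mul_of_pairing h1 (hb i) (hb' i) (by simp [h.pairing])
  refine ⟨fun i => (⟨a' i, a i, haa i, by rw [mul_comm, haa]⟩,
    ⟨b' i, b i, hbb i, by rw [mul_comm, hbb]⟩),
    conjRel_of_eigenbasis h.right h.left (fun i j => ?_) ha' ha hb' hb⟩
  rw [← (stdForm_isAlt n).neg_eq, h.pairing]
  split_ifs with h1 h2 h2 <;> simp_all

lemma stdForm_single {n : ℕ} (p q : Fin n ⊕ Fin n) :
    stdForm n (Pi.single (idx n p) 1) (Pi.single (idx n q) 1) = Matrix.J (Fin n) ℂ p q := by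
  rw [stdForm_apply]
  simp [Jstd_idx]

lemma torusMat_mulVec_single {n : ℕ} (a : Fin n → ℂˣ) (p : Fin n ⊕ Fin n) :
    torusMat a *ᵥ Pi.single (idx n p) 1 = torusEntries a p • Pi.single (idx n p) 1 := by
  funext k
  rw [torusMat, Matrix.mulVec_diagonal]
  by_cases h : k = idx n p
  · subst h; simp
  · simp [h]

/-- Pairs in the torus related by the Weyl group are conjugate. -/
lemma conjRel_of_weyl {n : ℕ} {e e' : Fin n → ℂˣ × ℂˣ} (σ : Equiv.Perm (Fin n))
    (h : ∀ i, e' i = e (σ i) ∨ e' i = (e (σ i))⁻¹) :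
    conjRel (Spset n) (ssTuples 2 (Spset n)) ⟨torusPair e', torusPair_mem e'⟩
      ⟨torusPair e, torusPair_mem e⟩ := by
  classical
  let v : Fin n → Fin (2 * n) → ℂ := fun i =>
    if e' i = e (σ i) then Pi.single (idx n (.inl (σ i))) 1 else Pi.single (idx n (.inr (σ i))) 1
  let w : Fin n → Fin (2 * n) → ℂ := fun i =>
    if e' i = e (σ i) then Pi.single (idx n (.inr (σ i))) 1
    else -Pi.single (idx n (.inl (σ i))) 1
  have key (i : Fin n) : (v i = Pi.single (idx n (.inl (σ i))) 1 ∧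
      w i = Pi.single (idx n (.inr (σ i))) 1 ∧ e' i = e (σ i)) ∨
      (v i = Pi.single (idx n (.inr (σ i))) 1 ∧
      w i = -Pi.single (idx n (.inl (σ i))) 1 ∧ e' i = (e (σ i))⁻¹) := by
    by_cases hi : e' i = e (σ i)
    · exact Or.inl ⟨if_pos hi, if_pos hi, hi⟩
    · exact Or.inr ⟨if_neg hi, if_neg hi, (h i).resolve_left hi⟩
  refine conjRel_of_eigenbasis (v := v) (w := w) (fun i j => ?_) (fun i j => ?_) (fun i j => ?_)
    (fun i => ?_) (fun i => ?_) (fun i => ?_) (fun i => ?_)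
  iterate 3
    by_cases hij : i = j
    · subst hij
      rcases key i with ⟨h1, h2, -⟩ | ⟨h1, h2, -⟩ <;>
        simp only [h1, h2, map_neg, LinearMap.neg_apply, stdForm_single, Matrix.J] <;> simp
    · have hij' : σ i ≠ σ j := fun h => hij (σ.injective h)
      rcases key i with ⟨h1, h2, -⟩ | ⟨h1, h2, -⟩ <;>
        rcases key j with ⟨h3, h4, -⟩ | ⟨h3, h4, -⟩ <;>
        simp only [h1, h2, h3, h4, map_neg, LinearMap.neg_apply, stdForm_single, Matrix.J] <;>
        simp [hij, hij']
  all_goals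
    rcases key i with ⟨h1, h2, h3⟩ | ⟨h1, h2, h3⟩ <;>
      simp only [h1, h2, h3, torusPair, Matrix.cons_val_zero, Matrix.cons_val_one,
        Matrix.mulVec_neg, torusMat_mulVec_single] <;>
      simp [torusEntries]

/-- The joint characteristic polynomial `det (x - A - tB)` of a pair of matrices. -/
noncomputable def jointCharpoly {m : ℕ} (f : Fin 2 → Matrix (Fin m) (Fin m) ℂ) (t x : ℂ) : ℂ :=
  (x • (1 : Matrix (Fin m) (Fin m) ℂ) - (f 0 + t • f 1)).det

lemma continuous_jointCharpoly (m : ℕ) : Continuous (jointCharpoly (m := m)) := by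
  unfold jointCharpoly
  fun_prop

lemma jointCharpoly_eq_of_conjRel {n : ℕ} {f g : ssTuples 2 (Spset n)}
    (h : conjRel (Spset n) (ssTuples 2 (Spset n)) f g) :
    jointCharpoly f.1 = jointCharpoly g.1 := by
  obtain ⟨P, Q, -, -, hPQ, hQP, hfg⟩ := h
  funext t x
  have : x • (1 : Matrix (Fin (2 * n)) (Fin (2 * n)) ℂ) - (g.1 0 + t • g.1 1) =
      P * (x • 1 - (f.1 0 + t • f.1 1)) * Q := by
    rw [← hfg 0, ← hfg 1]
    simp only [Matrix.mul_sub, Matrix.sub_mul, Matrix.mul_add, Matrix.add_mul, Matrix.mul_smul,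
      Matrix.smul_mul, Matrix.mul_one, hPQ]
  rw [jointCharpoly, jointCharpoly, this, Matrix.det_mul_right_comm, hPQ, Matrix.one_mul]

/-- The joint eigenvalues of a pair of points of the torus. -/
def torusPoints {n : ℕ} (e : Fin n → ℂˣ × ℂˣ) : Fin n ⊕ Fin n → ℂˣ × ℂˣ :=
  Sum.elim e e⁻¹

lemma torusEntries_fst {n : ℕ} (e : Fin n → ℂˣ × ℂˣ) (p : Fin n ⊕ Fin n) :
    torusEntries (fun i => (e i).1) p = (torusPoints e p).1 := by
  cases p <;> rfl

lemma torusEntries_snd {n : ℕ} (e : Fin n → ℂˣ × ℂˣ) (p : Fin n ⊕ Fin n) :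
    torusEntries (fun i => (e i).2) p = (torusPoints e p).2 := by
  cases p <;> rfl

lemma jointCharpoly_torusPair {n : ℕ} (e : Fin n → ℂˣ × ℂˣ) (t x : ℂ) :
    jointCharpoly (torusPair e) t x =
      ∏ p, (x - ((torusPoints e p).1 + t * (torusPoints e p).2)) := by
  have h : x • (1 : Matrix (Fin (2 * n)) (Fin (2 * n)) ℂ) - (torusPair e 0 + t • torusPair e 1) =
      Matrix.diagonal fun k => x - ((torusPoints e ((idx n).symm k)).1 +
        t * (torusPoints e ((idx n).symm k)).2) := by
    simp only [torusPair, Matrix.cons_val_zero, Matrix.cons_val_one, torusMat, torusEntries_fst,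
      torusEntries_snd, ← Matrix.diagonal_one, ← Matrix.diagonal_smul, Matrix.diagonal_add,
      Matrix.diagonal_sub]
    simp
  rw [jointCharpoly, h, Matrix.det_diagonal]
  exact Equiv.prod_comp (idx n).symm
    fun p => x - ((torusPoints e p).1 + t * (torusPoints e p).2 : ℂ)

lemma exists_separating_slope (s : Finset (ℂˣ × ℂˣ)) :
    ∃ t : ℂ, ∀ p ∈ s, ∀ q ∈ s, (p.1 + t * p.2 : ℂ) = q.1 + t * q.2 → p = q := by
  classical
  obtain ⟨t, ht⟩ := Infinite.exists_notMem_finset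
    ((s ×ˢ s).image fun r : (ℂˣ × ℂˣ) × (ℂˣ × ℂˣ) => ((r.1.1 - r.2.1) / (r.2.2 - r.1.2) : ℂ))
  refine ⟨t, fun p hp q hq h => ?_⟩
  have h2 : p.2 = q.2 := by
    by_contra hne
    have hne' : (q.2 - p.2 : ℂ) ≠ 0 := sub_ne_zero.2 fun h => hne (Units.ext h.symm)
    refine ht (Finset.mem_image.2 ⟨(p, q), Finset.mk_mem_product hp hq, ?_⟩)
    rw [div_eq_iff hne']
    linear_combination h
  refine Prod.ext (Units.ext ?_) h2
  rw [h2] at h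
  exact add_right_cancel h

lemma map_univ_eq_of_prod_sub_eq {ι : Type*} [Fintype ι] {a b : ι → ℂ}
    (h : ∀ x, ∏ i, (x - a i) = ∏ i, (x - b i)) :
    Finset.univ.val.map a = Finset.univ.val.map b := by
  have hp : ∏ i, (Polynomial.X - Polynomial.C (a i)) =
      ∏ i, (Polynomial.X - Polynomial.C (b i)) := by
    refine Polynomial.funext fun x => ?_
    simpa [Polynomial.eval_prod] using h x
  have hr (c : ι → ℂ) : (∏ i, (Polynomial.X - Polynomial.C (c i))).roots =
      Finset.univ.val.map c := by
    rw [← Polynomial.roots_multiset_prod_X_sub_C (Finset.univ.val.map c), Multiset.map_map]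
    rfl
  rw [← hr a, hp, hr b]

lemma map_univ_pair_inv {n : ℕ} (e : Fin n → ℂˣ × ℂˣ) :
    (Finset.univ.val.map fun p => ({torusPoints e p, (torusPoints e p)⁻¹} : Set (ℂˣ × ℂˣ))) =
      (Finset.univ.val.map fun i => ({e i, (e i)⁻¹} : Set (ℂˣ × ℂˣ))) +
        Finset.univ.val.map fun i => ({e i, (e i)⁻¹} : Set (ℂˣ × ℂˣ)) := by
  have hsum {ι : Type} [Fintype ι] (c : ι → Set (ℂˣ × ℂˣ)) :
      Finset.univ.val.map c = ∑ i, ({c i} : Multiset (Set (ℂˣ × ℂˣ))) := by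
    rw [← Multiset.sum_map_singleton (Finset.univ.val.map c), Multiset.map_map]
    rfl
  simp only [hsum, Fintype.sum_sum_type, torusPoints, Sum.elim_inl, Sum.elim_inr, Pi.inv_apply,
    inv_inv, Set.pair_comm (_)⁻¹]

/-- The joint characteristic polynomial separates Weyl group orbits in the torus. -/
lemma exists_perm_of_jointCharpoly_eq {n : ℕ} {e e' : Fin n → ℂˣ × ℂˣ}
    (h : jointCharpoly (torusPair e') = jointCharpoly (torusPair e)) :
    ∃ σ : Equiv.Perm (Fin n), ∀ i, e' i = e (σ i) ∨ e' i = (e (σ i))⁻¹ := by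
  classical
  obtain ⟨t, ht⟩ := exists_separating_slope
    (Finset.univ.image (torusPoints e) ∪ Finset.univ.image (torusPoints e'))
  have hmap : (Finset.univ.val.map fun p =>
        ((torusPoints e' p).1 + t * (torusPoints e' p).2 : ℂ)) =
      Finset.univ.val.map fun p => ((torusPoints e p).1 + t * (torusPoints e p).2 : ℂ) := by
    refine map_univ_eq_of_prod_sub_eq fun x => ?_
    rw [← jointCharpoly_torusPair, ← jointCharpoly_torusPair, h]
  obtain ⟨τ, hτ⟩ := exists_perm_of_map_univ_eq hmap
  have hτ' (p) : torusPoints e (τ p) = torusPoints e' p :=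
    ht _ (by simp) _ (by simp) (hτ p)
  have h2 : (Finset.univ.val.map fun p =>
        ({torusPoints e' p, (torusPoints e' p)⁻¹} : Set (ℂˣ × ℂˣ))) =
      Finset.univ.val.map fun p => ({torusPoints e p, (torusPoints e p)⁻¹} : Set (ℂˣ × ℂˣ)) := by
    simp only [← hτ']
    conv_rhs => rw [← Multiset.map_univ_val_equiv τ, Multiset.map_map]
    rfl
  rw [map_univ_pair_inv, map_univ_pair_inv] at h2
  have h3 : (Finset.univ.val.map fun i => ({e' i, (e' i)⁻¹} : Set (ℂˣ × ℂˣ))) =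
      Finset.univ.val.map fun i => ({e i, (e i)⁻¹} : Set (ℂˣ × ℂˣ)) := by
    ext c
    have hc := congrArg (Multiset.count c) h2
    rw [Multiset.count_add, Multiset.count_add] at hc
    omega
  obtain ⟨σ, hσ⟩ := exists_perm_of_map_univ_eq h3
  refine ⟨σ, fun i => ?_⟩
  have hi : e' i ∈ ({e (σ i), (e (σ i))⁻¹} : Set (ℂˣ × ℂˣ)) := hσ i ▸ Set.mem_insert _ _
  simpa using hi

lemma continuous_torusMat (n : ℕ) : Continuous (torusMat (n := n)) := by
  refine Continuous.matrix_diagonal (continuous_pi fun k => ?_)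
  rcases (idx n).symm k with i | i
  · exact Units.continuous_val.comp (continuous_apply i)
  · exact Units.continuous_val.comp (continuous_inv.comp (continuous_apply i))

lemma continuous_torusPair (n : ℕ) : Continuous (torusPair (n := n)) := by
  refine continuous_pi fun i => ?_
  fin_cases i
  · exact (continuous_torusMat n).comp (continuous_pi fun i => (continuous_apply i).fst)
  · exact (continuous_torusMat n).comp (continuous_pi fun i => (continuous_apply i).snd)

/-- The map sending a pair of points of the torus to its conjugation class. -/
def torusToRep (n : ℕ) (e : Fin n → ℂˣ × ℂˣ) : RepSpace (Spset n) (ssTuples 2 (Spset n)) :=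
  Quot.mk _ ⟨torusPair e, torusPair_mem e⟩

lemma continuous_torusToRep (n : ℕ) : Continuous (torusToRep n) :=
  continuous_quot_mk.comp ((continuous_torusPair n).subtype_mk _)

lemma torusToRep_surjective (n : ℕ) : Function.Surjective (torusToRep n) := by
  rintro ⟨f⟩
  obtain ⟨e, he⟩ := exists_conjRel_torusPair f
  exact ⟨e, Quot.sound he⟩

lemma torusToRep_eq_iff {n : ℕ} {e e' : Fin n → ℂˣ × ℂˣ} :
    torusToRep n e' = torusToRep n e ↔
      ∃ σ : Equiv.Perm (Fin n), ∀ i, e' i = e (σ i) ∨ e' i = (e (σ i))⁻¹ := by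
  refine ⟨fun h => exists_perm_of_jointCharpoly_eq ?_,
    fun ⟨σ, h⟩ => Quot.sound (conjRel_of_weyl σ h)⟩
  exact congrArg (Quot.lift (fun f : ssTuples 2 (Spset n) => jointCharpoly f.1)
    fun _ _ => jointCharpoly_eq_of_conjRel) h

lemma norm_eigenvalue_le {m : ℕ} {A : Matrix (Fin m) (Fin m) ℂ} {x : Fin m → ℂ} {a : ℂ}
    (hx : x ≠ 0) (h : A *ᵥ x = a • x) : ‖a‖ ≤ ∑ k, ∑ l, ‖A k l‖ := by
  have hb : ‖a • x‖ ≤ (∑ k, ∑ l, ‖A k l‖) * ‖x‖ := by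
    rw [← h]
    refine (pi_norm_le_iff_of_nonneg (by positivity)).2 fun k => ?_
    calc ‖(A *ᵥ x) k‖ ≤ ∑ l, ‖A k l * x l‖ := norm_sum_le Finset.univ fun l => A k l * x l
      _ ≤ ∑ l, ‖A k l‖ * ‖x‖ := by
        gcongr with l
        rw [norm_mul]
        gcongr
        exact norm_le_pi_norm x l
      _ = (∑ l, ‖A k l‖) * ‖x‖ := by rw [Finset.sum_mul]
      _ ≤ (∑ k, ∑ l, ‖A k l‖) * ‖x‖ := by
        refine mul_le_mul_of_nonneg_right ?_ (norm_nonneg x)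
        exact Finset.single_le_sum (f := fun k => ∑ l, ‖A k l‖) (fun _ _ => by positivity)
          (Finset.mem_univ k)
  rw [norm_smul] at hb
  exact le_of_mul_le_mul_right hb (norm_pos_iff.2 hx)

/-- The sum of the norms of all entries of a pair of matrices. -/
noncomputable def entryNorm {m : ℕ} (f : Fin 2 → Matrix (Fin m) (Fin m) ℂ) : ℝ :=
  ∑ i, ∑ k, ∑ l, ‖f i k l‖

lemma continuous_entryNorm (m : ℕ) : Continuous (entryNorm (m := m)) := by
  unfold entryNorm
  fun_prop

lemma norm_torusPoints_le {n : ℕ} {f : ssTuples 2 (Spset n)} {e : Fin n → ℂˣ × ℂˣ}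
    (h : conjRel (Spset n) (ssTuples 2 (Spset n)) ⟨torusPair e, torusPair_mem e⟩ f)
    (p : Fin n ⊕ Fin n) :
    ‖((torusPoints e p).1 : ℂ)‖ ≤ entryNorm f.1 ∧ ‖((torusPoints e p).2 : ℂ)‖ ≤ entryNorm f.1 := by
  obtain ⟨P, Q, -, -, hPQ, hQP, hf⟩ := h
  have hx : P *ᵥ Pi.single (idx n p) (1 : ℂ) ≠ 0 := fun h0 => by
    have h1 := congrArg (fun x => Q *ᵥ x) h0
    simp only [Matrix.mulVec_mulVec, hQP, Matrix.one_mulVec, Matrix.mulVec_zero] at h1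
    simpa using congrFun h1 (idx n p)
  have key (i : Fin 2) (c : ℂ) (hc : torusPair e i *ᵥ Pi.single (idx n p) (1 : ℂ) =
      c • Pi.single (idx n p) (1 : ℂ)) : ‖c‖ ≤ entryNorm f.1 := by
    refine (norm_eigenvalue_le (A := f.1 i) (a := c) hx ?_).trans
      (Finset.single_le_sum (f := fun i => ∑ k, ∑ l, ‖f.1 i k l‖) (fun _ _ => by positivity)
        (Finset.mem_univ i))
    rw [← hf i, Matrix.mulVec_mulVec, Matrix.mul_assoc, hQP, Matrix.mul_one,
      ← Matrix.mulVec_mulVec, hc, Matrix.mulVec_smul]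
  refine ⟨key 0 _ ?_, key 1 _ ?_⟩
  · rw [← torusEntries_fst]
    exact torusMat_mulVec_single _ _
  · rw [← torusEntries_snd]
    exact torusMat_mulVec_single _ _

lemma isCompact_bounded_units (R : ℝ) :
    IsCompact {z : ℂˣ | ‖(z : ℂ)‖ ≤ R ∧ ‖((z⁻¹ : ℂˣ) : ℂ)‖ ≤ R} := by
  have hR : IsCompact (Metric.closedBall (0 : ℂ) R) := isCompact_closedBall 0 R
  have h := Units.isClosedEmbedding_embedProduct.isCompact_preimage
    (hR.prod (MulOpposite.opHomeomorph.symm.isCompact_preimage.2 hR))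
  convert h using 1
  ext z
  simp [Units.embedProduct]

lemma isCompact_bounded_torus (n : ℕ) (R : ℝ) :
    IsCompact {e : Fin n → ℂˣ × ℂˣ | ∀ p, ‖((torusPoints e p).1 : ℂ)‖ ≤ R ∧
      ‖((torusPoints e p).2 : ℂ)‖ ≤ R} := by
  have h := isCompact_univ_pi fun _ : Fin n =>
    (isCompact_bounded_units R).prod (isCompact_bounded_units R)
  convert h using 1
  ext e
  simp only [Set.mem_ofPred_eq, Sum.forall, torusPoints, Sum.elim_inl, Sum.elim_inr, Pi.inv_apply,
    Prod.fst_inv, Prod.snd_inv, Set.mem_univ_pi, Set.mem_prod, ← forall_and]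
  exact forall_congr' fun i => by tauto

lemma isQuotientMap_torusToRep (n : ℕ) : Topology.IsQuotientMap (torusToRep n) := by
  refine Topology.isQuotientMap_iff_isClosed.2 ⟨torusToRep_surjective n, fun C =>
    ⟨fun hC => hC.preimage (continuous_torusToRep n), fun hC => ?_⟩⟩
  have hq : Topology.IsQuotientMap
    (Quot.mk (conjRel (Spset n) (ssTuples 2 (Spset n)))) := isQuotientMap_quot_mk
  rw [← hq.isClosed_preimage, isClosed_iff_ultrafilter]
  intro x u hux hu
  choose E hE using exists_conjRel_torusPair (n := n)
  have hqE (s) : torusToRep n (E s) = Quot.mk _ s := Quot.sound (hE s)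
  have hbound : ∀ᶠ s : ssTuples 2 (Spset n) in u, entryNorm s.1 < entryNorm x.1 + 1 :=
    hux (((continuous_entryNorm _).comp continuous_subtype_val).continuousAt.eventually_lt
      continuousAt_const (lt_add_one _))
  obtain ⟨e, -, he⟩ := (isCompact_bounded_torus n (entryNorm x.1 + 1)).ultrafilter_le_nhds
    (u.map E) (by
      rw [Filter.le_principal_iff, Ultrafilter.coe_map, Filter.mem_map]
      filter_upwards [hbound] with s hs p
      obtain ⟨h1, h2⟩ := norm_torusPoints_le (hE s) p
      exact ⟨h1.trans hs.le, h2.trans hs.le⟩)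
  have heC : e ∈ torusToRep n ⁻¹' C := by
    refine isClosed_iff_ultrafilter.1 hC _ (u.map E) he ?_
    refine Ultrafilter.mem_map.2 (Filter.mem_of_superset (Ultrafilter.mem_coe.2 hu) fun s hs => ?_)
    rwa [Set.mem_preimage, Set.mem_preimage, hqE]
  have hlim1 : Filter.Tendsto (fun s => jointCharpoly (torusPair (E s))) u
      (nhds (jointCharpoly (torusPair e))) :=
    (((continuous_jointCharpoly _).comp (continuous_torusPair n)).tendsto e).comp he
  have hlim2 : Filter.Tendsto (fun s => jointCharpoly (torusPair (E s))) u
      (nhds (jointCharpoly x.1)) := by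
    simp only [fun s => jointCharpoly_eq_of_conjRel (hE s)]
    exact (((continuous_jointCharpoly _).comp continuous_subtype_val).tendsto x).mono_left hux
  have heq : jointCharpoly (torusPair (E x)) = jointCharpoly (torusPair e) :=
    (jointCharpoly_eq_of_conjRel (hE x)).trans (tendsto_nhds_unique hlim2 hlim1)
  have hrep := torusToRep_eq_iff.2 (exists_perm_of_jointCharpoly_eq heq)
  rw [Set.mem_preimage, ← hqE, hrep]
  exact heC

/-- Shrinking a nonzero complex number along the ray through it towards the unit circle. -/
noncomputable def shrink (t : ℝ) (z : ℂˣ) : ℂˣ :=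
  Units.mk0 ((‖(z : ℂ)‖ ^ (-t) : ℝ) * (z : ℂ)) (mul_ne_zero
    (Complex.ofReal_ne_zero.2 (Real.rpow_pos_of_pos (norm_pos_iff.2 z.ne_zero) _).ne') z.ne_zero)

lemma continuous_shrink : Continuous fun p : ℝ × ℂˣ => shrink p.1 p.2 := by
  rw [Units.isEmbedding_val₀.continuous_iff]
  have hz : Continuous fun p : ℝ × ℂˣ => (p.2 : ℂ) := Units.continuous_val.comp continuous_snd
  refine (Complex.continuous_ofReal.comp (hz.norm.rpow continuous_fst.neg fun p =>
    Or.inl (norm_ne_zero_iff.2 p.2.ne_zero))).mul hz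

lemma shrink_zero (z : ℂˣ) : shrink 0 z = z := by
  ext
  simp [shrink]

lemma shrink_inv (t : ℝ) (z : ℂˣ) : shrink t z⁻¹ = (shrink t z)⁻¹ := by
  ext
  simp [shrink, Real.inv_rpow, mul_comm]

lemma norm_shrink_one (z : ℂˣ) : ‖(shrink 1 z : ℂ)‖ = 1 := by
  simp [shrink, Real.rpow_neg_one]

lemma shrink_one_toUnits (z : Circle) : shrink 1 (Circle.toUnits z) = Circle.toUnits z := by
  ext
  simp [shrink, Circle.norm_coe]

/-- The radial retraction of the nonzero complex numbers onto the unit circle. -/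
noncomputable def toCircle (z : ℂˣ) : Circle :=
  ⟨shrink 1 z, mem_sphere_zero_iff_norm.2 (norm_shrink_one z)⟩

lemma continuous_toCircle : Continuous toCircle :=
  (Units.continuous_val.comp
    (continuous_shrink.comp (continuous_const.prodMk continuous_id))).subtype_mk _

lemma toUnits_toCircle (z : ℂˣ) : Circle.toUnits (toCircle z) = shrink 1 z := by
  ext
  rfl

lemma toUnits_injective : Function.Injective Circle.toUnits := fun _ _ h =>
  Circle.ext (congrArg Units.val h)

lemma toCircle_toUnits (z : Circle) : toCircle (Circle.toUnits z) = z :=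
  toUnits_injective (by rw [toUnits_toCircle, shrink_one_toUnits])

lemma toCircle_inv (z : ℂˣ) : toCircle z⁻¹ = (toCircle z)⁻¹ :=
  toUnits_injective (by rw [map_inv, toUnits_toCircle, toUnits_toCircle, shrink_inv])

lemma continuous_toUnits : Continuous Circle.toUnits := by
  rw [Units.isEmbedding_val₀.continuous_iff]
  exact continuous_subtype_val

/-- Applying a map to both components of all members of a family of pairs. -/
def mapPairs {n : ℕ} {G H : Type*} (φ : G → H) (e : Fin n → G × G) : Fin n → H × H :=
  fun i => (φ (e i).1, φ (e i).2)

/-- Maps commuting with inversion are compatible with the action of the Weyl group. -/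
lemma exists_perm_mapPairs {n : ℕ} {G H : Type*} [Inv G] [Inv H] {φ : G → H}
    (hφ : ∀ z, φ z⁻¹ = (φ z)⁻¹) {e e' : Fin n → G × G}
    (h : ∃ σ : Equiv.Perm (Fin n), ∀ i, e' i = e (σ i) ∨ e' i = (e (σ i))⁻¹) :
    ∃ σ : Equiv.Perm (Fin n), ∀ i, mapPairs φ e' i = mapPairs φ e (σ i) ∨
      mapPairs φ e' i = (mapPairs φ e (σ i))⁻¹ := by
  obtain ⟨σ, h⟩ := h
  refine ⟨σ, fun i => (h i).imp (fun hi => by rw [mapPairs, hi, mapPairs]) fun hi => ?_⟩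
  rw [mapPairs, hi, Prod.fst_inv, Prod.snd_inv, hφ, hφ, mapPairs, Prod.inv_mk]

lemma continuous_mapPairs {n : ℕ} {T G H : Type*} [TopologicalSpace T] [TopologicalSpace G]
    [TopologicalSpace H] {φ : T → G → H} (hφ : Continuous fun p : T × G => φ p.1 p.2) :
    Continuous fun p : T × (Fin n → G × G) => mapPairs (φ p.1) p.2 := by
  refine continuous_pi fun i => ?_
  have h : Continuous fun p : T × (Fin n → G × G) => p.2 i :=
    (continuous_apply i).comp continuous_snd
  exact (hφ.comp (continuous_fst.prodMk h.fst)).prodMk (hφ.comp (continuous_fst.prodMk h.snd))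

lemma continuous_mapPairs_const {n : ℕ} {G H : Type*} [TopologicalSpace G] [TopologicalSpace H]
    {φ : G → H} (hφ : Continuous φ) : Continuous (mapPairs (n := n) φ) :=
  (continuous_mapPairs (T := Unit) (φ := fun _ => φ) (hφ.comp continuous_snd)).comp
    ((continuous_const (y := ())).prodMk continuous_id)

lemma exists_continuousMap_lift {X Y Z : Type*} [TopologicalSpace X] [TopologicalSpace Y]
    [TopologicalSpace Z] {f : X → Y} (hf : Topology.IsQuotientMap f) {g : X → Z}
    (hg : Continuous g) (h : ∀ a b, f a = f b → g a = g b) :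
    ∃ F : C(Y, Z), ∀ x, F (f x) = g x :=
  ⟨hf.lift (f := ⟨f, hf.continuous⟩) ⟨g, hg⟩ h,
    DFunLike.congr_fun (hf.lift_comp (f := ⟨f, hf.continuous⟩) ⟨g, hg⟩ h)⟩

/-- Radial retraction of eigenvalues induces a map from conjugation classes to projective space. -/
lemma exists_repToProj (n : ℕ) :
    ∃ F : C(RepSpace (Spset n) (ssTuples 2 (Spset n)), Projectivization ℂ (Fin (n + 1) → ℂ)),
      ∀ e, F (torusToRep n e) = torusToProj n (mapPairs toCircle e) :=
  exists_continuousMap_lift (isQuotientMap_torusToRep n)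
    ((continuous_torusToProj n).comp (continuous_mapPairs_const continuous_toCircle))
    fun _ _ h => (torusToProj_eq_iff.2
      (exists_perm_mapPairs toCircle_inv (torusToRep_eq_iff.1 h.symm)))

/-- The inclusion of the circle induces a map from projective space to conjugation classes. -/
lemma exists_projToRep (n : ℕ) :
    ∃ F : C(Projectivization ℂ (Fin (n + 1) → ℂ), RepSpace (Spset n) (ssTuples 2 (Spset n))),
      ∀ e, F (torusToProj n e) = torusToRep n (mapPairs Circle.toUnits e) :=
  exists_continuousMap_lift (isQuotientMap_torusToProj n)
    ((continuous_torusToRep n).comp (continuous_mapPairs_const continuous_toUnits))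
    fun _ _ h => (torusToRep_eq_iff.2
      (exists_perm_mapPairs (map_inv Circle.toUnits) (torusToProj_eq_iff.1 h.symm)))

lemma continuous_mapPairs_shrink (n : ℕ) :
    Continuous fun p : (Fin n → ℂˣ × ℂˣ) × unitInterval => mapPairs (shrink (p.2 : ℝ)) p.1 := by
  have hp : Continuous fun p : (Fin n → ℂˣ × ℂˣ) × unitInterval => ((p.2 : ℝ), p.1) := by
    fun_prop
  have hm := continuous_mapPairs (n := n) (φ := shrink) continuous_shrink
  have h := hm.comp hp
  exact h

/-- Shrinking eigenvalues to the unit circle induces paths of conjugation classes. -/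
lemma exists_shrinkRep (n : ℕ) :
    ∃ F : C(RepSpace (Spset n) (ssTuples 2 (Spset n)),
        C(unitInterval, RepSpace (Spset n) (ssTuples 2 (Spset n)))),
      ∀ e t, F (torusToRep n e) t = torusToRep n (mapPairs (shrink t) e) := by
  let G : C((Fin n → ℂˣ × ℂˣ) × unitInterval, RepSpace (Spset n) (ssTuples 2 (Spset n))) :=
    ⟨fun p => torusToRep n (mapPairs (shrink p.2) p.1),
      (continuous_torusToRep n).comp (continuous_mapPairs_shrink n)⟩
  obtain ⟨F, hF⟩ := exists_continuousMap_lift (isQuotientMap_torusToRep n) (g := G.curry)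
    G.curry.continuous fun _ _ h => ContinuousMap.ext fun t => torusToRep_eq_iff.2
      (exists_perm_mapPairs (shrink_inv t) (torusToRep_eq_iff.1 h))
  exact ⟨F, fun e t => DFunLike.congr_fun (hF e) t⟩

end SpPairs

/-- Example 4.5(2) of Biswas–Florentino for `G = Sp(2n,ℂ)`: the space of conjugation
classes of pairs of commuting semisimple elements of `Sp(2n,ℂ)` is homotopy equivalent
to `ℂP^n`, the projectivization of `ℂ^{n+1}`. -/
theorem symplectic_pairs_char_variety_homotopyEquiv_CP (n : ℕ) (hn : 1 ≤ n) :
    Nonempty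
      (ContinuousMap.HomotopyEquiv
        (RepSpace (Spset n) (ssTuples 2 (Spset n)))
        (Projectivization ℂ (Fin (n+1) → ℂ))) := by
  obtain ⟨f, hf⟩ := SpPairs.exists_repToProj n
  obtain ⟨g, hg⟩ := SpPairs.exists_projToRep n
  obtain ⟨F, hF⟩ := SpPairs.exists_shrinkRep n
  refine ⟨⟨f, g, .symm ⟨⟨(ContinuousMap.uncurry F).comp ContinuousMap.prodSwap,
    fun x => ?_, fun x => ?_⟩⟩, ?_⟩⟩
  · obtain ⟨e, rfl⟩ := SpPairs.torusToRep_surjective n x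
    refine (hF e 0).trans (congrArg _ (funext fun i => ?_))
    exact Prod.ext (SpPairs.shrink_zero _) (SpPairs.shrink_zero _)
  · obtain ⟨e, rfl⟩ := SpPairs.torusToRep_surjective n x
    refine (hF e 1).trans ?_
    rw [ContinuousMap.comp_apply, hf, hg]
    refine congrArg _ (funext fun i => ?_)
    exact Prod.ext (SpPairs.toUnits_toCircle _).symm (SpPairs.toUnits_toCircle _).symm
  · have hfg : f.comp g = .id _ := by
      ext x
      obtain ⟨e, rfl⟩ := SpPairs.torusToProj_surjective n x
      rw [ContinuousMap.comp_apply, hg, hf]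
      refine congrArg _ (funext fun i => ?_)
      exact Prod.ext (SpPairs.toCircle_toUnits _) (SpPairs.toCircle_toUnits _)
    rw [hfg]
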